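/- There exists a constant C > 0, depending only on the dimension 3, with the following property: for every u ∈ L¹(𝕋₃; Sym(3)) with div u = 0 in the sense of distributions on the torus and every λ > 0 there exists u_λ ∈ L¹(𝕋₃; Sym(3)) satisfying (1) ‖u_λ‖_{L^∞(𝕋₃)} ≤ C λ; (2) ‖u − u_λ‖_{L¹(𝕋₃)} ≤ C ∫_{{|u| > λ}} |u| dx; (3) ℒ³({x ∈ 𝕋₃ : u(x) ≠ u_λ(x)}) ≤ C λ⁻¹ ∫_{{|u| > λ}} |u| dx; and (4) div u_λ = 0 in the sense of distributions. -/

import Mathlib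

/-!
Divergence-free `L^∞`-truncation of symmetric-matrix valued `L¹` fields on the
torus `𝕋₃ = ℝ³/ℤ³` (Proposition 5.1).  The torus is encoded via `ℤ³`-periodic
functions on `ℝ³`, with the unit cube `unitBox` as fundamental domain.
-/

noncomputable section
open MeasureTheory
open scoped ENNReal

/-- The underlying space `ℝ³` of the torus `𝕋₃ = ℝ³/ℤ³`. -/
abbrev Dom3 : Type := Fin 3 → ℝ

/-- 3×3 real matrices with the Frobenius norm. -/
abbrev M33 : Type := EuclideanSpace ℝ (Fin 3 × Fin 3)

/-- A 3×3 matrix is symmetric. -/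
def IsSym3 (A : M33) : Prop := ∀ i j : Fin 3, A (i, j) = A (j, i)

/-- The fundamental domain `[0,1)³` of the torus. -/
def unitBox : Set Dom3 := Set.univ.pi fun _ => Set.Ico (0 : ℝ) 1

/-- `ℤ³`-periodicity: the defining property of functions on the torus `𝕋₃`. -/
def PeriodicZ3 {E : Type*} (φ : Dom3 → E) : Prop :=
  ∀ (x : Dom3) (m : Fin 3 → ℤ), φ (x + fun i => (m i : ℝ)) = φ x

/-- `div u = 0` in `𝒟'(𝕋₃; ℝ³)`, row-wise: for every row `α` and every smooth
function `ψ : 𝕋₃ → ℝ` one has `∫_{𝕋₃} u_α · ∇ψ dx = 0`. -/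
def DistDivFreeTorus (u : Dom3 → M33) : Prop :=
  ∀ ψ : Dom3 → ℝ, ContDiff ℝ (⊤ : ℕ∞) ψ → PeriodicZ3 ψ → ∀ α : Fin 3,
    (∫ x in unitBox, ∑ β : Fin 3, u x (α, β) * fderiv ℝ ψ x (Pi.single β 1)) = 0

open Set Filter Topology Metric
open scoped NNReal

section Lattice

/-- The lattice `ℤ³` inside `ℝ³`. -/
def intLattice : AddSubgroup Dom3 := ((Int.castAddHom ℝ).compLeft (Fin 3)).range

theorem mem_intLattice {x : Dom3} : x ∈ intLattice ↔ ∃ m : Fin 3 → ℤ, (fun i => (m i : ℝ)) = x :=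
  Iff.rfl

instance : Countable intLattice := by
  have : (intLattice : Set Dom3).Countable := by
    have h := Set.countable_range (fun m : Fin 3 → ℤ => (fun i => (m i : ℝ) : Dom3))
    exact h
  exact this.to_subtype

theorem measurableSet_unitBox : MeasurableSet unitBox :=
  MeasurableSet.univ_pi fun _ => measurableSet_Ico

theorem volume_unitBox : volume unitBox = 1 := by
  simp [unitBox, Real.volume_pi_Ico]

theorem existsUnique_vadd_mem_unitBox (x : Dom3) : ∃! g : intLattice, g +ᵥ x ∈ unitBox := by
  refine ⟨⟨fun i => ((-⌊x i⌋ : ℤ) : ℝ), mem_intLattice.2 ⟨_, rfl⟩⟩, ?_, ?_⟩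
  · intro i _
    simp only [AddSubgroup.vadd_def, vadd_eq_add, Pi.add_apply, Int.cast_neg, mem_Ico]
    constructor <;> linarith [Int.floor_le (x i), Int.lt_floor_add_one (x i)]
  · rintro ⟨g, hg⟩ h
    obtain ⟨m, rfl⟩ := mem_intLattice.1 hg
    ext i
    have := h i (mem_univ i)
    simp only [AddSubgroup.vadd_def, vadd_eq_add, Pi.add_apply, mem_Ico] at this
    have h2 : ⌊x i⌋ = - m i := by
      rw [Int.floor_eq_iff]; push_cast; constructor <;> linarith
    simp [h2]

instance : VAddInvariantMeasure intLattice (Dom3 × Dom3) (volume.prod volume) where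
  measure_preimage_vadd c s hs := by
    have h1 : MeasurePreserving (fun x : Dom3 => (c : Dom3) + x) volume volume :=
      measurePreserving_add_left _ _
    exact (h1.prod h1).measure_preimage hs.nullMeasurableSet

theorem isAddFundamentalDomain_unitBox_prod_univ :
    IsAddFundamentalDomain intLattice (unitBox ×ˢ (univ : Set Dom3)) (volume.prod volume) := by
  refine IsAddFundamentalDomain.mk'
    (measurableSet_unitBox.prod MeasurableSet.univ).nullMeasurableSet fun x => ?_
  simpa using existsUnique_vadd_mem_unitBox x.1

theorem isAddFundamentalDomain_univ_prod_unitBox :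
    IsAddFundamentalDomain intLattice ((univ : Set Dom3) ×ˢ unitBox) (volume.prod volume) := by
  refine IsAddFundamentalDomain.mk'
    (MeasurableSet.univ.prod measurableSet_unitBox).nullMeasurableSet fun x => ?_
  simpa using existsUnique_vadd_mem_unitBox x.2

/-- Unfolding: for a diagonally periodic function, integrating one variable over the torus and the
other one over the whole space does not depend on which variable is which. -/
theorem integral_unitBox_swap {F : Dom3 × Dom3 → ℝ}
    (hF : ∀ (m : Fin 3 → ℤ) (x y : Dom3),
      F (x + fun i => (m i : ℝ), y + fun i => (m i : ℝ)) = F (x, y))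
    (hint : IntegrableOn F (unitBox ×ˢ univ) (volume.prod volume)) :
    IntegrableOn F (univ ×ˢ unitBox) (volume.prod volume) ∧
    ∫ x in unitBox, ∫ y, F (x, y) = ∫ y in unitBox, ∫ x, F (x, y) := by
  have hinv : ∀ (g : intLattice) (p : Dom3 × Dom3), F (g +ᵥ p) = F p := by
    rintro ⟨g, hg⟩ ⟨x, y⟩
    obtain ⟨m, rfl⟩ := mem_intLattice.1 hg
    rw [← hF m x y]
    simp only [AddSubgroup.vadd_def, Prod.vadd_mk, vadd_eq_add]
    rw [add_comm x, add_comm y]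
  have h1 := isAddFundamentalDomain_unitBox_prod_univ
  have h2 := isAddFundamentalDomain_univ_prod_unitBox
  have hint2 : IntegrableOn F (univ ×ˢ unitBox) (volume.prod volume) :=
    (h1.integrableOn_iff h2 hinv).1 hint
  refine ⟨hint2, ?_⟩
  have e1 := setIntegral_prod F hint
  have e2 := h1.setIntegral_eq h2 hinv
  simp only [Measure.restrict_univ] at e1
  rw [← e1, e2]
  rw [IntegrableOn, ← Measure.prod_restrict] at hint2
  rw [← Measure.prod_restrict, integral_prod_symm _ hint2]
  simp

theorem setLIntegral_image_add_unitBox {g : Dom3 → ℝ≥0∞} (hg : PeriodicZ3 g) (m : Fin 3 → ℤ) :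
    ∫⁻ x in (fun x : Dom3 => x + fun i => (m i : ℝ)) '' unitBox, g x = ∫⁻ x in unitBox, g x := by
  have h1 : MeasurePreserving (fun x : Dom3 => x + fun i => (m i : ℝ)) volume volume :=
    measurePreserving_add_right _ _
  rw [← h1.setLIntegral_comp_emb (measurableEmbedding_addRight _)]
  exact lintegral_congr fun x => hg x m

theorem setLIntegral_closedBall_le {g : Dom3 → ℝ≥0∞} (hg : PeriodicZ3 g) (x : Dom3) {r : ℝ}
    (hr : 0 ≤ r) :
    ∫⁻ y in closedBall x r, g y ≤ ENNReal.ofReal ((2 * r + 2) ^ 3) * ∫⁻ y in unitBox, g y := by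
  classical
  set S : Finset (Fin 3 → ℤ) := Fintype.piFinset fun i => Finset.Icc ⌊x i - r⌋ ⌊x i + r⌋
  have hsub : closedBall x r ⊆
      ⋃ m : S, (fun x : Dom3 => x + fun i => (m.1 i : ℝ)) '' unitBox := by
    intro y hy
    have hy' : ∀ i, |y i - x i| ≤ r := by
      intro i
      have := (dist_pi_le_iff hr).1 (mem_closedBall.1 hy) i
      rwa [Real.dist_eq] at this
    simp only [mem_iUnion]
    refine ⟨⟨fun i => ⌊y i⌋, ?_⟩, fun i => Int.fract (y i), ?_, ?_⟩
    · simp only [S, Fintype.mem_piFinset, Finset.mem_Icc]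
      intro i
      have := abs_le.1 (hy' i)
      exact ⟨Int.floor_le_floor (by linarith), Int.floor_le_floor (by linarith)⟩
    · intro i _
      exact ⟨Int.fract_nonneg _, Int.fract_lt_one _⟩
    · ext i
      simp
  have hcard : (S.card : ℝ) ≤ (2 * r + 2) ^ 3 := by
    simp only [S, Fintype.card_piFinset, Int.card_Icc, Nat.cast_prod]
    have : ∀ i : Fin 3, ((⌊x i + r⌋ + 1 - ⌊x i - r⌋).toNat : ℝ) ≤ 2 * r + 2 := by
      intro i
      have h0 : 0 ≤ ⌊x i + r⌋ + 1 - ⌊x i - r⌋ := by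
        have := Int.floor_le_floor (show x i - r ≤ x i + r by linarith)
        lia
      rw [← Int.cast_natCast, Int.toNat_of_nonneg h0]
      push_cast
      linarith [Int.floor_le (x i + r), Int.lt_floor_add_one (x i - r)]
    calc _ ≤ ∏ i : Fin 3, (2 * r + 2) := Finset.prod_le_prod (fun _ _ => by positivity)
            fun i _ => this i
      _ = _ := by simp
  calc ∫⁻ y in closedBall x r, g y
      ≤ ∫⁻ y in ⋃ m : S, (fun x : Dom3 => x + fun i => (m.1 i : ℝ)) '' unitBox, g y :=
        lintegral_mono_set hsub
    _ ≤ ∑ m ∈ S, ∫⁻ y in (fun x : Dom3 => x + fun i => (m i : ℝ)) '' unitBox, g y := by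
        refine (lintegral_iUnion_le _ _).trans_eq ?_
        rw [tsum_fintype, Finset.sum_coe_sort S fun m =>
          ∫⁻ y in (fun x : Dom3 => x + fun i => (m i : ℝ)) '' unitBox, g y]
    _ = S.card * ∫⁻ y in unitBox, g y := by
        rw [Finset.sum_congr rfl fun m _ => setLIntegral_image_add_unitBox hg m, Finset.sum_const,
          nsmul_eq_mul]
    _ ≤ _ := by
        gcongr
        rw [← ENNReal.ofReal_natCast]
        exact ENNReal.ofReal_le_ofReal hcard

end Lattice

section Weight

/-- The profile `(1 - |z|²)₊`, with the Euclidean norm `|z|`. -/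
def bumpWeight (z : Dom3) : ℝ := max 0 (1 - ∑ i, z i ^ 2)

/-- A compactly supported function whose gradient at `z` is `bumpWeight z • z`. -/
def bumpPrimitive (z : Dom3) : ℝ := 2⁻¹ * ∫ t in (1 : ℝ)..∑ i, z i ^ 2, max 0 (1 - t)

theorem continuous_bumpWeight : Continuous bumpWeight := by
  unfold bumpWeight; fun_prop

theorem bumpWeight_nonneg (z : Dom3) : 0 ≤ bumpWeight z := le_max_left _ _

theorem bumpWeight_le_one (z : Dom3) : bumpWeight z ≤ 1 :=
  max_le zero_le_one (by linarith [Finset.sum_nonneg fun i (_ : i ∈ Finset.univ) => sq_nonneg (z i)])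

theorem one_lt_sum_sq {z : Dom3} (hz : 1 < ‖z‖) : 1 < ∑ i, z i ^ 2 := by
  by_contra! h
  refine hz.not_ge ((pi_norm_le_iff_of_nonneg zero_le_one).2 fun i => ?_)
  have h1 : z i ^ 2 ≤ ∑ i, z i ^ 2 :=
    Finset.single_le_sum (f := fun i => z i ^ 2) (fun i _ => sq_nonneg (z i)) (Finset.mem_univ i)
  rw [Real.norm_eq_abs]
  exact (sq_le_one_iff_abs_le_one _).1 (h1.trans h)

theorem bumpWeight_eq_zero {z : Dom3} (hz : 1 < ‖z‖) : bumpWeight z = 0 :=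
  max_eq_left (by linarith [one_lt_sum_sq hz])

theorem hasCompactSupport_bumpWeight : HasCompactSupport bumpWeight :=
  HasCompactSupport.intro (isCompact_closedBall (0 : Dom3) 1) fun z hz =>
    bumpWeight_eq_zero (by simpa using hz)

theorem integral_bumpWeight_pos : 0 < ∫ z, bumpWeight z :=
  continuous_bumpWeight.integral_pos_of_hasCompactSupport_nonneg_nonzero
    hasCompactSupport_bumpWeight bumpWeight_nonneg (x := 0) (by simp [bumpWeight])

theorem hasCompactSupport_bumpPrimitive : HasCompactSupport bumpPrimitive :=
  HasCompactSupport.intro (isCompact_closedBall (0 : Dom3) 1) fun z hz => by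
    have h1 : 1 < ∑ i, z i ^ 2 := one_lt_sum_sq (by simpa using hz)
    have h2 : ∫ t in (1 : ℝ)..∑ i, z i ^ 2, max 0 (1 - t) = 0 := by
      refine intervalIntegral.integral_zero_ae (Eventually.of_forall fun t ht => ?_)
      rw [uIoc_of_le h1.le] at ht
      exact max_eq_left (by linarith [ht.1])
    simp [bumpPrimitive, h2]

theorem hasFDerivAt_bumpPrimitive (z : Dom3) :
    HasFDerivAt bumpPrimitive
      (bumpWeight z • ∑ i, z i • ContinuousLinearMap.proj (R := ℝ) (φ := fun _ : Fin 3 => ℝ) i) z := by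
  have h1 : HasDerivAt (fun s : ℝ => ∫ t in (1 : ℝ)..s, max 0 (1 - t)) (bumpWeight z)
      (∑ i, z i ^ 2) := by
    have hc : Continuous fun t : ℝ => max 0 (1 - t) := by fun_prop
    exact intervalIntegral.integral_hasDerivAt_right (hc.intervalIntegrable _ _)
      (hc.stronglyMeasurableAtFilter _ _) hc.continuousAt
  have h2 : HasFDerivAt (fun z : Dom3 => ∑ i, z i ^ 2)
      (∑ i, (2 * z i) • ContinuousLinearMap.proj (R := ℝ) (φ := fun _ : Fin 3 => ℝ) i) z := by
    refine HasFDerivAt.fun_sum fun i _ => ?_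
    simpa using (hasFDerivAt_apply (𝕜 := ℝ) (F' := fun _ : Fin 3 => ℝ) i z).pow 2
  have h3 := (h1.comp_hasFDerivAt z h2).const_mul 2⁻¹
  refine h3.congr_fderiv ?_
  simp only [Finset.smul_sum, smul_smul]
  refine Finset.sum_congr rfl fun i _ => ?_
  congr 1
  ring

theorem fderiv_bumpPrimitive (z : Dom3) (k : Fin 3) :
    fderiv ℝ bumpPrimitive z (Pi.single k 1) = bumpWeight z * z k := by
  rw [(hasFDerivAt_bumpPrimitive z).fderiv]
  simp [Pi.single_apply]

theorem differentiable_bumpPrimitive : Differentiable ℝ bumpPrimitive :=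
  fun z => (hasFDerivAt_bumpPrimitive z).differentiableAt

/-- `bumpWeight z • z` is a gradient, hence pairs symmetrically with gradients. -/
theorem integral_bumpWeight_mul_fderiv_comm {F : Dom3 → ℝ} (hF : ContDiff ℝ 2 F) (a k : Fin 3) :
    ∫ z, bumpWeight z * z a * fderiv ℝ F z (Pi.single k 1) =
      ∫ z, bumpWeight z * z k * fderiv ℝ F z (Pi.single a 1) := by
  have hF1 : ContDiff ℝ 1 (fderiv ℝ F) := hF.fderiv_right (by norm_num)
  have hFv : ∀ v : Dom3, ContDiff ℝ 1 fun z => fderiv ℝ F z v := fun v => hF1.clm_apply contDiff_const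
  have hcs := hasCompactSupport_bumpPrimitive
  have hHc : Continuous bumpPrimitive := differentiable_bumpPrimitive.continuous
  have key : ∀ a k : Fin 3, ∫ z, bumpWeight z * z a * fderiv ℝ F z (Pi.single k 1) =
      - ∫ z, bumpPrimitive z * fderiv ℝ (fun z => fderiv ℝ F z (Pi.single k 1)) z (Pi.single a 1) := by
    intro a k
    have hc2 : Continuous fun z =>
        fderiv ℝ (fun z => fderiv ℝ F z (Pi.single k 1)) z (Pi.single a 1) :=
      ((hFv (Pi.single k 1)).continuous_fderiv (by norm_num)).clm_apply continuous_const
    rw [integral_mul_fderiv_eq_neg_fderiv_mul_of_integrable (f := bumpPrimitive), neg_neg]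
    · simp only [fderiv_bumpPrimitive]
    · simp only [fderiv_bumpPrimitive]
      refine Continuous.integrable_of_hasCompactSupport ?_ ?_
      · have := continuous_bumpWeight
        have := (hFv (Pi.single k 1)).continuous
        fun_prop
      · exact (hasCompactSupport_bumpWeight.mul_right).mul_right
    · exact (hHc.mul hc2).integrable_of_hasCompactSupport hcs.mul_right
    · exact (hHc.mul (hFv _).continuous).integrable_of_hasCompactSupport hcs.mul_right
    · exact fun z _ => differentiable_bumpPrimitive z
    · exact fun z _ => (hFv _).differentiable (by norm_num) z
  rw [key a k, key k a]
  congr 1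
  refine integral_congr_ae (Eventually.of_forall fun z => ?_)
  have hsymm : IsSymmSndFDerivAt ℝ F z := hF.contDiffAt.isSymmSndFDerivAt (by simp)
  have hd : DifferentiableAt ℝ (fderiv ℝ F) z := hF1.differentiable (by norm_num) z
  have e : ∀ a k : Fin 3, fderiv ℝ (fun z => fderiv ℝ F z (Pi.single k 1)) z (Pi.single a 1) =
      fderiv ℝ (fderiv ℝ F) z (Pi.single a 1) (Pi.single k 1) := by
    intro a k
    rw [fderiv_clm_apply hd (by fun_prop)]
    simp
  simp only [e]
  rw [hsymm.eq]

end Weight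

section LipschitzTest

theorem PeriodicZ3.fderiv {f : Dom3 → ℝ} (hf : PeriodicZ3 f) : PeriodicZ3 (fderiv ℝ f) := by
  intro x m
  rw [← fderiv_comp_add_right]
  congr 1
  exact funext fun y => hf y m

/-- A periodic function is determined by its values on the unit box. -/
theorem PeriodicZ3.forall_of_unitBox {E : Type*} {f : Dom3 → E} (hf : PeriodicZ3 f) {p : E → Prop}
    (h : ∀ x ∈ unitBox, p (f x)) (x : Dom3) : p (f x) := by
  have h1 := h (fun i => Int.fract (x i)) fun i _ => ⟨Int.fract_nonneg _, Int.fract_lt_one _⟩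
  have h2 := hf (fun i => Int.fract (x i)) fun i => ⌊x i⌋
  rw [← h2] at h1
  convert h1 using 2
  ext i
  simp

theorem unitBox_subset_closedBall : unitBox ⊆ closedBall (0 : Dom3) 1 := by
  intro x hx
  rw [mem_closedBall_zero_iff, pi_norm_le_iff_of_nonneg zero_le_one]
  intro i
  have := hx i (mem_univ i)
  rw [Real.norm_eq_abs, abs_le]
  constructor <;> linarith [this.1, this.2]

theorem PeriodicZ3.exists_bound {E : Type*} [NormedAddCommGroup E] {f : Dom3 → E}
    (hf : PeriodicZ3 f) (hc : Continuous f) : ∃ L : ℝ≥0, ∀ x, ‖f x‖ ≤ L := by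
  obtain ⟨L, hL⟩ := (isCompact_closedBall (0 : Dom3) 1).exists_bound_of_continuousOn hc.continuousOn
  refine ⟨L.toNNReal, hf.forall_of_unitBox (p := fun y => ‖y‖ ≤ L.toNNReal) fun x hx => ?_⟩
  exact (hL x (unitBox_subset_closedBall hx)).trans (Real.le_coe_toNNReal L)

/-- Mollification of a Lipschitz function, as an average of translates. -/
theorem hasFDerivAt_integral_translates {g : Dom3 → ℝ} {L : ℝ≥0} (hg : LipschitzWith L g)
    {w : Dom3 → ℝ} (hw : Continuous w) (hws : HasCompactSupport w) (x : Dom3) :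
    HasFDerivAt (fun x => ∫ t, w t • g (x - t)) (∫ t, w t • fderiv ℝ g (x - t)) x := by
  have hgc := hg.continuous
  refine (hasFDerivAt_integral_of_dominated_loc_of_lip (s := univ)
    (bound := fun t => |w t| * L) univ_mem ?_ ?_ ?_ ?_ ?_ ?_).2
  · exact Eventually.of_forall fun y => by fun_prop
  · refine Continuous.integrable_of_hasCompactSupport (by fun_prop) hws.smul_right
  · exact (hw.measurable.smul ((measurable_fderiv ℝ g).comp
      (measurable_const.sub measurable_id))).aestronglyMeasurable
  · refine Eventually.of_forall fun t => LipschitzWith.lipschitzOnWith ?_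
    refine LipschitzWith.of_dist_le_mul fun y z => ?_
    have := hg.dist_le_mul (y - t) (z - t)
    rw [dist_sub_right] at this
    rw [Real.dist_eq, ← smul_sub, smul_eq_mul, abs_mul, ← Real.dist_eq, Real.coe_nnabs, abs_mul,
      abs_abs, NNReal.abs_eq, mul_assoc]
    gcongr
  · exact (hw.abs.integrable_of_hasCompactSupport hws.abs).mul_const _
  · have h1 := (Measure.measurePreserving_sub_left volume x).quasiMeasurePreserving.ae
      hg.ae_differentiableAt
    filter_upwards [h1] with t ht
    have h2 := ht.hasFDerivAt.comp x ((hasFDerivAt_id x).sub_const t)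
    rw [ContinuousLinearMap.comp_id] at h2
    exact h2.const_smul (w t)

/-- Fields that are divergence-free on the torus annihilate gradients of periodic Lipschitz
functions. -/
theorem DistDivFreeTorus.integral_lipschitz {u : Dom3 → M33} (hu : DistDivFreeTorus u)
    (hint : IntegrableOn u unitBox) {g : Dom3 → ℝ} {L : ℝ≥0} (hg : LipschitzWith L g)
    (hgp : PeriodicZ3 g) (α : Fin 3) :
    ∫ x in unitBox, ∑ β : Fin 3, u x (α, β) * fderiv ℝ g x (Pi.single β 1) = 0 := by
  let φ : ℕ → ContDiffBump (0 : Dom3) := fun n =>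
    ⟨1 / (n + 1), 2 * (1 / (n + 1)), by positivity, by
      have : (0 : ℝ) < 1 / (n + 1) := by positivity
      linarith⟩
  have hφ : Tendsto (fun n => (φ n).rOut) atTop (𝓝 0) := by
    simpa [φ] using tendsto_one_div_add_atTop_nhds_zero_nat.const_mul (2 : ℝ)
  let w : ℕ → Dom3 → ℝ := fun n => (φ n).normed volume
  have hwc : ∀ n, Continuous (w n) := fun n => (φ n).continuous_normed
  have hws : ∀ n, HasCompactSupport (w n) := fun n => (φ n).hasCompactSupport_normed
  let G : ℕ → Dom3 → ℝ := fun n x => ∫ t, w n t • g (x - t)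
  have hGd : ∀ n x v, fderiv ℝ (G n) x v = ∫ t, w n t • fderiv ℝ g (x - t) v := by
    intro n x v
    have hm : Measurable fun t => fderiv ℝ g (x - t) :=
      (measurable_fderiv ℝ g).comp (measurable_const.sub measurable_id)
    have hi : Integrable fun t => w n t • fderiv ℝ g (x - t) := by
      refine Integrable.mono' (((hwc n).abs.integrable_of_hasCompactSupport (hws n).abs).mul_const L)
        ((hwc n).measurable.smul hm).aestronglyMeasurable (Eventually.of_forall fun t => ?_)
      rw [norm_smul, Real.norm_eq_abs]
      gcongr
      exact norm_fderiv_le_of_lipschitz ℝ hg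
    rw [(hasFDerivAt_integral_translates hg (hwc n) (hws n) x).fderiv,
      ContinuousLinearMap.integral_apply hi]
    rfl
  have hGb : ∀ n x v, |fderiv ℝ (G n) x v| ≤ L * ‖v‖ := by
    intro n x v
    rw [hGd, ← Real.norm_eq_abs]
    have h1 : ∫ t, w n t * (L * ‖v‖) = L * ‖v‖ := by
      rw [integral_mul_const, (φ n).integral_normed, one_mul]
    rw [← h1]
    refine norm_integral_le_of_norm_le
      (((hwc n).integrable_of_hasCompactSupport (hws n)).mul_const _)
      (Eventually.of_forall fun t => ?_)
    rw [norm_smul, Real.norm_of_nonneg ((φ n).nonneg_normed t)]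
    gcongr
    · exact (φ n).nonneg_normed t
    · exact ContinuousLinearMap.le_of_opNorm_le _ (norm_fderiv_le_of_lipschitz ℝ hg) v
  have hGs : ∀ n, ContDiff ℝ (⊤ : ℕ∞) (G n) := fun n =>
    (hws n).contDiff_convolution_left (ContinuousLinearMap.lsmul ℝ ℝ) (φ n).contDiff_normed
      (hg.continuous.locallyIntegrable (μ := volume))
  have hGp : ∀ n, PeriodicZ3 (G n) := by
    intro n x m
    simp only [G]
    congr 1
    ext t
    rw [add_sub_right_comm, hgp]
  have hlim : ∀ v : Dom3, ∀ᵐ x, Tendsto (fun n => fderiv ℝ (G n) x v) atTop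
      (𝓝 (fderiv ℝ g x v)) := by
    intro v
    have hm : Measurable fun y => fderiv ℝ g y v := measurable_fderiv_apply_const ℝ g v
    have hloc : LocallyIntegrable (fun y => fderiv ℝ g y v) volume := by
      refine (locallyIntegrable_const (L * ‖v‖)).mono hm.aestronglyMeasurable
        (Eventually.of_forall fun y => ?_)
      refine (ContinuousLinearMap.le_of_opNorm_le _ (norm_fderiv_le_of_lipschitz ℝ hg) v).trans ?_
      exact le_abs_self _
    filter_upwards [ContDiffBump.ae_convolution_tendsto_right_of_locallyIntegrable (K := 2) hφ
      (Eventually.of_forall fun n => le_rfl) hloc] with x hx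
    simp only [hGd]
    exact hx
  have hzero : ∀ n, ∫ x in unitBox, ∑ β : Fin 3, u x (α, β) * fderiv ℝ (G n) x (Pi.single β 1) = 0 :=
    fun n => hu (G n) (hGs n) (hGp n) α
  have hcomp : ∀ β, IntegrableOn (fun x => u x (α, β)) unitBox := fun β =>
    (EuclideanSpace.proj (𝕜 := ℝ) (α, β)).integrable_comp hint
  have htend : Tendsto (fun n => ∫ x in unitBox, ∑ β : Fin 3,
      u x (α, β) * fderiv ℝ (G n) x (Pi.single β 1)) atTop
      (𝓝 (∫ x in unitBox, ∑ β : Fin 3, u x (α, β) * fderiv ℝ g x (Pi.single β 1))) := by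
    refine tendsto_integral_of_dominated_convergence
      (fun x => ∑ β : Fin 3, |u x (α, β)| * L) (fun n => ?_) ?_ (fun n => ?_) ?_
    · refine Finset.aestronglyMeasurable_fun_sum _ fun β _ => (hcomp β).1.mul ?_
      exact (measurable_fderiv_apply_const ℝ (G n) _).aestronglyMeasurable
    · exact integrable_finsetSum _ fun β _ => (hcomp β).abs.mul_const _
    · refine Eventually.of_forall fun x => (norm_sum_le _ _).trans (Finset.sum_le_sum fun β _ => ?_)
      rw [norm_mul, Real.norm_eq_abs, Real.norm_eq_abs]
      gcongr
      simpa [Pi.norm_single] using hGb n x (Pi.single β 1)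
    · have h3 : ∀ᵐ x, ∀ β : Fin 3, Tendsto (fun n => fderiv ℝ (G n) x (Pi.single β 1)) atTop
          (𝓝 (fderiv ℝ g x (Pi.single β 1))) := ae_all_iff.2 fun β => hlim _
      filter_upwards [ae_restrict_of_ae h3] with x hx
      exact tendsto_finsetSum _ fun β _ => (hx β).const_mul _
  simp only [hzero] at htend
  exact (tendsto_nhds_unique htend tendsto_const_nhds)

end LipschitzTest

section Maximal

theorem PeriodicZ3.integrableOn_closedBall {E : Type*} [NormedAddCommGroup E] {f : Dom3 → E}
    (hf : PeriodicZ3 f) (hm : StronglyMeasurable f) (hint : IntegrableOn f unitBox) (x : Dom3)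
    (r : ℝ) : IntegrableOn f (closedBall x r) := by
  refine ⟨hm.aestronglyMeasurable, ?_⟩
  have hp : PeriodicZ3 fun x => ‖f x‖ₑ := fun x m => by simp only [hf x m]
  have hle : ∫⁻ y in closedBall x r, ‖f y‖ₑ ≤ ∫⁻ y in closedBall x |r|, ‖f y‖ₑ :=
    lintegral_mono_set (closedBall_subset_closedBall (le_abs_self r))
  exact (hle.trans (setLIntegral_closedBall_le hp x (abs_nonneg r))).trans_lt
    (ENNReal.mul_lt_top ENNReal.ofReal_lt_top hint.2)

theorem PeriodicZ3.locallyIntegrable {E : Type*} [NormedAddCommGroup E] {f : Dom3 → E}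
    (hf : PeriodicZ3 f) (hm : StronglyMeasurable f) (hint : IntegrableOn f unitBox) :
    LocallyIntegrable f := fun x =>
  ⟨closedBall x 1, closedBall_mem_nhds x one_pos, hf.integrableOn_closedBall hm hint x 1⟩

theorem volume_closedBall_pi3 (x : Dom3) {r : ℝ} (hr : 0 ≤ r) :
    volume (closedBall x r) = ENNReal.ofReal ((2 * r) ^ 3) := by
  simp [Real.volume_pi_closedBall x hr]

/-- The set where the maximal function of `g` exceeds `lam`. -/
def badSet (g : Dom3 → ℝ≥0∞) (lam : ℝ) : Set Dom3 :=
  {x | ∃ r > 0, ENNReal.ofReal (lam * (2 * r) ^ 3) < ∫⁻ y in closedBall x r, g y}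

variable {g : Dom3 → ℝ≥0∞} {lam : ℝ}

theorem isOpen_badSet : IsOpen (badSet g lam) := by
  rw [Metric.isOpen_iff]
  rintro x ⟨r, hr, h⟩
  have hcont : Tendsto (fun e : ℝ => ENNReal.ofReal (lam * (2 * (r + e)) ^ 3)) (𝓝[>] 0)
      (𝓝 (ENNReal.ofReal (lam * (2 * r) ^ 3))) := by
    have : Continuous fun e : ℝ => ENNReal.ofReal (lam * (2 * (r + e)) ^ 3) :=
      ENNReal.continuous_ofReal.comp (by fun_prop)
    have h2 := this.tendsto 0
    simp only [add_zero] at h2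
    exact h2.mono_left nhdsWithin_le_nhds
  obtain ⟨e, he, he0⟩ := ((hcont.eventually_lt_const h).and self_mem_nhdsWithin).exists
  have he0' : 0 < e := he0
  refine ⟨e, he0', fun y hy => ⟨r + e, by positivity, he.trans_le (lintegral_mono_set ?_)⟩⟩
  refine closedBall_subset_closedBall' ?_
  rw [dist_comm]
  linarith [mem_ball.1 hy]

theorem setLIntegral_closedBall_add (hg : PeriodicZ3 g) (x : Dom3) (m : Fin 3 → ℤ) (r : ℝ) :
    ∫⁻ y in closedBall (x + fun i => (m i : ℝ)) r, g y = ∫⁻ y in closedBall x r, g y := by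
  have h1 : MeasurePreserving (fun x : Dom3 => x + fun i => (m i : ℝ)) volume volume :=
    measurePreserving_add_right _ _
  have h2 : (fun y : Dom3 => y + fun i => (m i : ℝ)) ⁻¹' closedBall (x + fun i => (m i : ℝ)) r =
      closedBall x r := by
    ext y
    simp [mem_closedBall]
  rw [← h1.setLIntegral_comp_preimage_emb (measurableEmbedding_addRight _), h2]
  exact lintegral_congr fun y => hg y m

theorem periodicZ3_mem_badSet (hg : PeriodicZ3 g) : PeriodicZ3 (· ∈ badSet g lam) := by
  intro x m
  simp only [badSet, mem_ofPred_eq, setLIntegral_closedBall_add hg]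

theorem radius_lt_one_of_lintegral_le (hg : PeriodicZ3 g)
    (hA : ∫⁻ x in unitBox, g x ≤ ENNReal.ofReal (lam / 8)) {x : Dom3} {r : ℝ}
    (h : ENNReal.ofReal (lam * (2 * r) ^ 3) < ∫⁻ y in closedBall x r, g y) : r < 1 := by
  by_contra! hr
  refine h.not_ge ((setLIntegral_closedBall_le hg x (by linarith)).trans ?_)
  calc ENNReal.ofReal ((2 * r + 2) ^ 3) * ∫⁻ x in unitBox, g x
      ≤ ENNReal.ofReal ((4 * r) ^ 3) * ENNReal.ofReal (lam / 8) := by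
        gcongr
        linarith
    _ = ENNReal.ofReal (lam * (2 * r) ^ 3) := by
        rw [← ENNReal.ofReal_mul (by positivity)]
        congr 1
        ring

/-- The weak-type estimate for the maximal function on the torus. -/
theorem volume_unitBox_inter_badSet_le (hg : PeriodicZ3 g) (hlam : 0 < lam)
    (hA : ∫⁻ x in unitBox, g x ≤ ENNReal.ofReal (lam / 8)) :
    volume (unitBox ∩ badSet g lam) ≤ ENNReal.ofReal (27000 / lam) * ∫⁻ x in unitBox, g x := by
  have hex : ∀ x : Dom3, ∃ r : ℝ, x ∈ badSet g lam →
      0 < r ∧ ENNReal.ofReal (lam * (2 * r) ^ 3) < ∫⁻ y in closedBall x r, g y := by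
    intro x
    by_cases hx : x ∈ badSet g lam
    · obtain ⟨r, hr⟩ := hx
      exact ⟨r, fun _ => hr⟩
    · exact ⟨0, fun h => absurd h hx⟩
  choose r hr using hex
  have hr1 : ∀ x ∈ badSet g lam, r x < 1 := fun x hx =>
    radius_lt_one_of_lintegral_le hg hA (hr x hx).2
  obtain ⟨S, hS, hdisj, hcov⟩ := Vitali.exists_disjoint_subfamily_covering_enlargement_closedBall
    (unitBox ∩ badSet g lam) id r 1 (fun x hx => (hr1 x hx.2).le) 5 (by norm_num)
  simp only [id] at hdisj hcov
  have hScount : S.Countable := by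
    refine hdisj.countable_of_nonempty_interior fun x hx => ?_
    exact ⟨x, ball_subset_interior_closedBall (mem_ball_self (hr x (hS hx).2).1)⟩
  have hsub : unitBox ∩ badSet g lam ⊆ ⋃ x ∈ S, closedBall x (5 * r x) := by
    intro x hx
    obtain ⟨y, hy, hxy⟩ := hcov x hx
    exact mem_biUnion hy (hxy (mem_closedBall_self (hr x hx.2).1.le))
  have hone : ∀ x ∈ S, volume (closedBall x (5 * r x)) ≤
      ENNReal.ofReal (125 / lam) * ∫⁻ y in closedBall x (r x), g y := by
    intro x hx
    obtain ⟨h0, h1⟩ := hr x (hS hx).2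
    rw [volume_closedBall_pi3 x (by positivity)]
    calc ENNReal.ofReal ((2 * (5 * r x)) ^ 3)
        = ENNReal.ofReal (125 / lam) * ENNReal.ofReal (lam * (2 * r x) ^ 3) := by
          rw [← ENNReal.ofReal_mul (by positivity)]
          congr 1
          field_simp
          ring
      _ ≤ _ := by gcongr
  have hball : ∀ x ∈ S, closedBall x (r x) ⊆ closedBall (0 : Dom3) 2 := by
    intro x hx
    refine closedBall_subset_closedBall' ?_
    have := mem_closedBall.1 (unitBox_subset_closedBall (hS hx).1)
    linarith [hr1 x (hS hx).2]
  calc volume (unitBox ∩ badSet g lam)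
      ≤ volume (⋃ x ∈ S, closedBall x (5 * r x)) := measure_mono hsub
    _ ≤ ∑' x : S, volume (closedBall (x : Dom3) (5 * r x)) := measure_biUnion_le _ hScount _
    _ ≤ ∑' x : S, ENNReal.ofReal (125 / lam) * ∫⁻ y in closedBall (x : Dom3) (r x), g y :=
        ENNReal.tsum_le_tsum fun x => hone x x.2
    _ = ENNReal.ofReal (125 / lam) * ∫⁻ y in ⋃ x ∈ S, closedBall x (r x), g y := by
        rw [ENNReal.tsum_mul_left, lintegral_biUnion hScount
          (fun x _ => measurableSet_closedBall) hdisj]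
    _ ≤ ENNReal.ofReal (125 / lam) * ∫⁻ y in closedBall (0 : Dom3) 2, g y := by
        gcongr
        exact iUnion₂_subset hball
    _ ≤ ENNReal.ofReal (125 / lam) *
          (ENNReal.ofReal ((2 * 2 + 2) ^ 3) * ∫⁻ y in unitBox, g y) := by
        gcongr
        exact setLIntegral_closedBall_le hg 0 (by norm_num)
    _ = ENNReal.ofReal (27000 / lam) * ∫⁻ y in unitBox, g y := by
        rw [← mul_assoc, ← ENNReal.ofReal_mul (by positivity)]
        congr 2
        ring

theorem ae_le_of_notMem_badSet {h : Dom3 → ℝ} (hp : PeriodicZ3 h) (hm : StronglyMeasurable h)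
    (h0 : ∀ x, 0 ≤ h x) (hint : IntegrableOn h unitBox) (hlam : 0 < lam) :
    ∀ᵐ x, x ∉ badSet (fun x => ENNReal.ofReal (h x)) lam → h x ≤ lam := by
  filter_upwards [IsUnifLocDoublingMeasure.ae_tendsto_average volume
    (hp.locallyIntegrable hm hint) 1] with x hx hbad
  have hlim := hx (fun _ : ℝ => x) (fun r : ℝ => r) (l := 𝓝[>] 0) tendsto_id
    (by filter_upwards [self_mem_nhdsWithin] with r hr
        exact mem_closedBall_self (by rw [one_mul]; exact le_of_lt hr))
  refine le_of_tendsto hlim ?_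
  filter_upwards [self_mem_nhdsWithin] with r hr
  have hr : 0 < r := hr
  have hle : ∫⁻ y in closedBall x r, ENNReal.ofReal (h y) ≤ ENNReal.ofReal (lam * (2 * r) ^ 3) := by
    by_contra! hlt
    exact hbad ⟨r, hr, hlt⟩
  have hI : ∫ y in closedBall x r, h y ≤ lam * (2 * r) ^ 3 := by
    rw [integral_eq_lintegral_of_nonneg_ae (Eventually.of_forall h0) hm.aestronglyMeasurable]
    exact ENNReal.toReal_le_of_le_ofReal (by positivity) hle
  rw [setAverage_eq, measureReal_def, volume_closedBall_pi3 x hr.le,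
    ENNReal.toReal_ofReal (by positivity), smul_eq_mul, inv_mul_le_iff₀ (by positivity)]
  linarith

end Maximal

section Kernel

/-- The vector `u(x) ∇δ(x)`. -/
def mulGrad (u : Dom3 → M33) (δ : Dom3 → ℝ) (x : Dom3) (a : Fin 3) : ℝ :=
  ∑ b, u x (a, b) * fderiv ℝ δ x (Pi.single b 1)

/-- The symmetric kernel dual to averaging at scale `δ`, in rescaled coordinates. -/
def scaledKernel (u : Dom3 → M33) (δ : Dom3 → ℝ) (a k : Fin 3) (x z : Dom3) : ℝ :=
  bumpWeight z * (u x (a, k) + mulGrad u δ x a * z k + mulGrad u δ x k * z a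
    - if a = k then ∑ l, mulGrad u δ x l * z l else 0)

/-- The symmetric kernel dual to averaging at scale `δ`. -/
def avgKernel (u : Dom3 → M33) (δ : Dom3 → ℝ) (a k : Fin 3) (p : Dom3 × Dom3) : ℝ :=
  (δ p.1)⁻¹ ^ 3 * scaledKernel u δ a k p.1 ((δ p.1)⁻¹ • (p.2 - p.1))

variable {u : Dom3 → M33} {δ : Dom3 → ℝ}

theorem avgKernel_symm (hsym : ∀ x, IsSym3 (u x)) (a k : Fin 3) :
    avgKernel u δ a k = avgKernel u δ k a := by
  ext p
  simp only [avgKernel, scaledKernel, hsym p.1 a k, eq_comm (a := a) (b := k)]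
  split_ifs with h
  · subst h; ring
  · ring

theorem abs_mulGrad_le (hδ : LipschitzWith 1 δ) (x : Dom3) (a : Fin 3) :
    |mulGrad u δ x a| ≤ 3 * ‖u x‖ := by
  have : ∀ b : Fin 3, |u x (a, b) * fderiv ℝ δ x (Pi.single b 1)| ≤ ‖u x‖ := by
    intro b
    have h1 : |u x (a, b)| ≤ ‖u x‖ := PiLp.norm_apply_le (u x) (a, b)
    have h2 : |fderiv ℝ δ x (Pi.single b 1)| ≤ 1 := by
      have := ContinuousLinearMap.le_of_opNorm_le _ (norm_fderiv_le_of_lipschitz ℝ hδ (x₀ := x))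
        (Pi.single b 1)
      simpa [Pi.norm_single] using this
    rw [abs_mul]
    nlinarith [abs_nonneg (u x (a, b)), norm_nonneg (u x)]
  calc |mulGrad u δ x a| ≤ ∑ b : Fin 3, |u x (a, b) * fderiv ℝ δ x (Pi.single b 1)| :=
        Finset.abs_sum_le_sum_abs _ _
    _ ≤ ∑ b : Fin 3, ‖u x‖ := Finset.sum_le_sum fun b _ => this b
    _ = 3 * ‖u x‖ := by simp

theorem scaledKernel_eq_zero {a k : Fin 3} {x z : Dom3} (hz : 1 < ‖z‖) :
    scaledKernel u δ a k x z = 0 := by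
  simp [scaledKernel, bumpWeight_eq_zero hz]

theorem abs_scaledKernel_le (hδ : LipschitzWith 1 δ) (a k : Fin 3) (x z : Dom3) :
    |scaledKernel u δ a k x z| ≤ 16 * ‖u x‖ := by
  rcases lt_or_ge 1 ‖z‖ with hz | hz
  · rw [scaledKernel_eq_zero hz, abs_zero]; positivity
  have hzi : ∀ i, |z i| ≤ 1 := fun i => (norm_le_pi_norm z i).trans hz
  have hp : ∀ l i, |mulGrad u δ x l * z i| ≤ 3 * ‖u x‖ := by
    intro l i
    rw [abs_mul]
    nlinarith [abs_mulGrad_le (u := u) hδ x l, hzi i, abs_nonneg (mulGrad u δ x l),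
      abs_nonneg (z i)]
  have hs : |if a = k then ∑ l, mulGrad u δ x l * z l else 0| ≤ 9 * ‖u x‖ := by
    split_ifs
    · calc |∑ l, mulGrad u δ x l * z l| ≤ ∑ l : Fin 3, |mulGrad u δ x l * z l| :=
            Finset.abs_sum_le_sum_abs _ _
        _ ≤ ∑ l : Fin 3, 3 * ‖u x‖ := Finset.sum_le_sum fun l _ => hp l l
        _ = 9 * ‖u x‖ := by simp; ring
    · rw [abs_zero]; positivity
  have h1 : |u x (a, k)| ≤ ‖u x‖ := PiLp.norm_apply_le (u x) (a, k)
  rw [scaledKernel, abs_mul, abs_of_nonneg (bumpWeight_nonneg z)]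
  have h4 : |u x (a, k) + mulGrad u δ x a * z k + mulGrad u δ x k * z a
      - if a = k then ∑ l, mulGrad u δ x l * z l else 0| ≤ 16 * ‖u x‖ := by
    rw [abs_le] at *
    have := abs_le.1 (hp a k)
    have := abs_le.1 (hp k a)
    constructor <;> linarith
  nlinarith [bumpWeight_nonneg z, bumpWeight_le_one z, norm_nonneg (u x)]

theorem measurable_mulGrad (hu : Measurable u) (a : Fin 3) :
    Measurable fun x => mulGrad u δ x a := by
  refine Finset.measurable_fun_sum _ fun b _ => ?_
  have h1 : Measurable fun x => u x (a, b) := (EuclideanSpace.proj (𝕜 := ℝ) (a, b)).measurable.comp hu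
  exact h1.mul (measurable_fderiv_apply_const ℝ δ _)

theorem measurable_scaledKernel (hu : Measurable u) (a k : Fin 3) :
    Measurable fun p : Dom3 × Dom3 => scaledKernel u δ a k p.1 p.2 := by
  have hm : ∀ a, Measurable fun p : Dom3 × Dom3 => mulGrad u δ p.1 a := fun a =>
    (measurable_mulGrad hu a).comp measurable_fst
  have h1 : Measurable fun p : Dom3 × Dom3 => u p.1 (a, k) :=
    (EuclideanSpace.proj (𝕜 := ℝ) (a, k)).measurable.comp (hu.comp measurable_fst)
  have hz : ∀ i, Measurable fun p : Dom3 × Dom3 => p.2 i := fun i =>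
    (measurable_pi_apply i).comp measurable_snd
  have hw : Measurable fun p : Dom3 × Dom3 => bumpWeight p.2 :=
    continuous_bumpWeight.measurable.comp measurable_snd
  have hs : Measurable fun p : Dom3 × Dom3 =>
      if a = k then ∑ l, mulGrad u δ p.1 l * p.2 l else 0 := by
    split_ifs
    · exact Finset.measurable_fun_sum _ fun l _ => (hm l).mul (hz l)
    · exact measurable_const
  exact hw.mul (((h1.add ((hm a).mul (hz k))).add ((hm k).mul (hz a))).sub hs)

theorem measurable_avgKernel (hu : Measurable u) (hδ : Continuous δ) (a k : Fin 3) :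
    Measurable (avgKernel u δ a k) := by
  have hd : Measurable fun p : Dom3 × Dom3 => (δ p.1)⁻¹ :=
    (hδ.measurable.comp measurable_fst).inv
  have hz : Measurable fun p : Dom3 × Dom3 => (δ p.1)⁻¹ • (p.2 - p.1) :=
    hd.smul (measurable_snd.sub measurable_fst)
  have h := (measurable_scaledKernel (δ := δ) hu a k).comp (measurable_fst.prodMk hz)
  unfold avgKernel
  exact (hd.pow_const 3).mul h

theorem avgKernel_add_int (hu : PeriodicZ3 u) (hδ : PeriodicZ3 δ) (a k : Fin 3)
    (m : Fin 3 → ℤ) (x y : Dom3) :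
    avgKernel u δ a k (x + fun i => (m i : ℝ), y + fun i => (m i : ℝ)) =
      avgKernel u δ a k (x, y) := by
  simp only [avgKernel, scaledKernel, mulGrad, hδ x m, hu x m, hδ.fderiv x m,
    add_sub_add_right_eq_sub]

theorem avgKernel_eq_zero_of_lt {a k : Fin 3} {x y : Dom3} (h0 : 0 ≤ δ x) (h : δ x < dist x y) :
    avgKernel u δ a k (x, y) = 0 := by
  rcases h0.eq_or_lt with h0 | h0
  · simp [avgKernel, ← h0]
  · simp only [avgKernel]
    rw [scaledKernel_eq_zero, mul_zero]
    rw [norm_smul, norm_inv, Real.norm_of_nonneg h0.le, ← dist_eq_norm, dist_comm,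
      inv_mul_eq_div, one_lt_div h0]
    exact h

theorem avgKernel_eq_zero_of_eq_zero {a k : Fin 3} {x y : Dom3} (h0 : δ x = 0) :
    avgKernel u δ a k (x, y) = 0 := by
  simp [avgKernel, h0]

theorem abs_avgKernel_le (hδ : LipschitzWith 1 δ) {a k : Fin 3} {x y : Dom3} (h0 : 0 ≤ δ x) :
    |avgKernel u δ a k (x, y)| ≤ (δ x)⁻¹ ^ 3 * (16 * ‖u x‖) := by
  rw [avgKernel, abs_mul, abs_of_nonneg (by positivity)]
  gcongr
  exact abs_scaledKernel_le hδ _ _ _ _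

theorem lintegral_avgKernel_le (hδ : LipschitzWith 1 δ) (h0 : ∀ x, 0 ≤ δ x) (a k : Fin 3)
    (x : Dom3) : ∫⁻ y, ‖avgKernel u δ a k (x, y)‖ₑ ≤ 128 * ‖u x‖ₑ := by
  rcases (h0 x).eq_or_lt with h | h
  · simp [avgKernel_eq_zero_of_eq_zero h.symm]
  calc ∫⁻ y, ‖avgKernel u δ a k (x, y)‖ₑ
      ≤ ∫⁻ y, (closedBall x (δ x)).indicator
          (fun _ => ENNReal.ofReal ((δ x)⁻¹ ^ 3 * (16 * ‖u x‖))) y := by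
        refine lintegral_mono fun y => ?_
        by_cases hy : y ∈ closedBall x (δ x)
        · rw [indicator_of_mem hy, ← ofReal_norm]
          exact ENNReal.ofReal_le_ofReal (abs_avgKernel_le hδ (h0 x))
        · rw [indicator_of_notMem hy, avgKernel_eq_zero_of_lt (h0 x)]
          · simp
          · rw [dist_comm]; simpa using hy
    _ = ENNReal.ofReal ((δ x)⁻¹ ^ 3 * (16 * ‖u x‖)) * ENNReal.ofReal ((2 * δ x) ^ 3) := by
        rw [lintegral_indicator_const measurableSet_closedBall, volume_closedBall_pi3 x (h0 x)]
    _ = ENNReal.ofReal (128 * ‖u x‖) := by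
        rw [← ENNReal.ofReal_mul (by positivity)]
        congr 1
        field_simp
        ring
    _ = 128 * ‖u x‖ₑ := by
        rw [ENNReal.ofReal_mul (by norm_num), ofReal_norm]
        simp

theorem integrableOn_avgKernel_mul (hu : Measurable u) (hint : IntegrableOn u unitBox)
    (hδ : LipschitzWith 1 δ) (h0 : ∀ x, 0 ≤ δ x) {q : Dom3 → ℝ} (hq : Measurable q) {M : ℝ≥0}
    (hM : ∀ x, ‖q x‖ ≤ M) (a k : Fin 3) :
    IntegrableOn (fun p : Dom3 × Dom3 => avgKernel u δ a k p * q p.2) (unitBox ×ˢ univ)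
      (volume.prod volume) := by
  have hK := measurable_avgKernel hu hδ.continuous a k
  rw [IntegrableOn, ← Measure.prod_restrict, Measure.restrict_univ]
  have hm : Measurable fun p : Dom3 × Dom3 => avgKernel u δ a k p * q p.2 :=
    hK.mul (hq.comp measurable_snd)
  refine ⟨hm.aestronglyMeasurable, ?_⟩
  rw [HasFiniteIntegral, lintegral_prod _ hm.enorm.aemeasurable]
  have hle : ∀ x, ∫⁻ y, ‖avgKernel u δ a k (x, y) * q y‖ₑ ≤ 128 * ‖u x‖ₑ * M := by
    intro x
    calc ∫⁻ y, ‖avgKernel u δ a k (x, y) * q y‖ₑ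
        ≤ ∫⁻ y, ‖avgKernel u δ a k (x, y)‖ₑ * M := by
          refine lintegral_mono fun y => ?_
          rw [enorm_mul]
          gcongr
          rw [← ofReal_norm]
          exact ENNReal.ofReal_le_of_le_toReal (by simpa using hM y)
      _ = (∫⁻ y, ‖avgKernel u δ a k (x, y)‖ₑ) * M :=
          lintegral_mul_const _ (hK.comp measurable_prodMk_left).enorm
      _ ≤ _ := by
          gcongr
          exact lintegral_avgKernel_le hδ h0 a k x
  refine (lintegral_mono hle).trans_lt ?_
  rw [lintegral_mul_const _ (hu.enorm.const_mul _), lintegral_const_mul _ hu.enorm]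
  exact ENNReal.mul_lt_top (ENNReal.mul_lt_top (by simp) hint.2) ENNReal.coe_lt_top

/-- Change of variables `y = x + δ(x) z`. -/
theorem integral_scaledKernel_mul {x : Dom3} (h : 0 < δ x) (q : Dom3 → ℝ) (a k : Fin 3) :
    ∫ z, scaledKernel u δ a k x z * q (x + δ x • z) = ∫ y, avgKernel u δ a k (x, y) * q y := by
  have h1 := Measure.integral_comp_smul volume
    (fun y => scaledKernel u δ a k x ((δ x)⁻¹ • y) * q (x + y)) (δ x)
  have h2 := integral_add_left_eq_self (μ := volume)
    (fun y => scaledKernel u δ a k x ((δ x)⁻¹ • (y - x)) * q y) x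
  simp only [add_sub_cancel_left] at h2
  simp only [smul_smul, inv_mul_cancel₀ h.ne', one_smul] at h1
  rw [h1, h2, smul_eq_mul, ← integral_const_mul]
  congr 1
  ext y
  rw [abs_of_pos (by positivity)]
  simp [avgKernel, mul_assoc]

end Kernel

section ScaleAverage

/-- The average of `f` at the variable scale `δ`. -/
def scaleAvg (δ : Dom3 → ℝ) (f : Dom3 → ℝ) (x : Dom3) : ℝ :=
  ∫ z, bumpWeight z * f (x + δ x • z)

variable {u : Dom3 → M33} {δ : Dom3 → ℝ} {f : Dom3 → ℝ} {L : ℝ≥0}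

theorem integrable_bumpWeight_mul {q : Dom3 → ℝ} (hq : Continuous q) :
    Integrable fun z => bumpWeight z * q z :=
  (continuous_bumpWeight.mul hq).integrable_of_hasCompactSupport
    hasCompactSupport_bumpWeight.mul_right

theorem scaleAvg_periodic (hδ : PeriodicZ3 δ) (hf : PeriodicZ3 f) : PeriodicZ3 (scaleAvg δ f) := by
  intro x m
  simp only [scaleAvg, hδ x m]
  congr 1
  ext z
  rw [add_right_comm, hf]

theorem norm_bumpWeight_mul_sub_le (hδ : LipschitzWith 1 δ) (hf : LipschitzWith L f)
    (x y z : Dom3) :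
    ‖bumpWeight z * f (x + δ x • z) - bumpWeight z * f (y + δ y • z)‖ ≤
      bumpWeight z * (2 * L) * ‖x - y‖ := by
  rcases lt_or_ge 1 ‖z‖ with hz | hz
  · simp [bumpWeight_eq_zero hz]
  rw [← mul_sub, norm_mul, Real.norm_of_nonneg (bumpWeight_nonneg z), mul_assoc]
  refine mul_le_mul_of_nonneg_left ?_ (bumpWeight_nonneg z)
  have h1 : ‖δ x - δ y‖ ≤ ‖x - y‖ := by simpa using hδ.norm_sub_le x y
  calc ‖f (x + δ x • z) - f (y + δ y • z)‖ ≤ L * ‖(x + δ x • z) - (y + δ y • z)‖ :=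
        hf.norm_sub_le _ _
    _ = L * ‖(x - y) + (δ x - δ y) • z‖ := by
        congr 2
        rw [sub_smul]; abel
    _ ≤ L * (‖x - y‖ + ‖x - y‖ * 1) := by
        gcongr
        refine (norm_add_le _ _).trans ?_
        rw [norm_smul]
        gcongr
    _ = 2 * L * ‖x - y‖ := by ring

theorem scaleAvg_lipschitz (hδ : LipschitzWith 1 δ) (hf : LipschitzWith L f) :
    LipschitzWith (Real.toNNReal ((∫ z, bumpWeight z) * (2 * L))) (scaleAvg δ f) := by
  refine LipschitzWith.of_dist_le_mul fun x y => ?_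
  have hi : ∀ x, Integrable fun z => bumpWeight z * f (x + δ x • z) := fun x =>
    integrable_bumpWeight_mul (hf.continuous.comp (by fun_prop))
  rw [Real.coe_toNNReal _ (mul_nonneg integral_bumpWeight_pos.le (by positivity)),
    dist_eq_norm, dist_eq_norm, scaleAvg, scaleAvg, ← integral_sub (hi x) (hi y),
    ← integral_mul_const, ← integral_mul_const]
  exact norm_integral_le_of_norm_le
    (((continuous_bumpWeight.integrable_of_hasCompactSupport
      hasCompactSupport_bumpWeight).mul_const _).mul_const _)
    (Eventually.of_forall fun z => norm_bumpWeight_mul_sub_le hδ hf x y z)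

theorem fderiv_scaleAvg (hδ : LipschitzWith 1 δ) (hf : LipschitzWith L f) (hfd : ContDiff ℝ 1 f)
    {x : Dom3} (hx : DifferentiableAt ℝ δ x) (b : Fin 3) :
    fderiv ℝ (scaleAvg δ f) x (Pi.single b 1) =
      (∫ z, bumpWeight z * fderiv ℝ f (x + δ x • z) (Pi.single b 1)) +
      fderiv ℝ δ x (Pi.single b 1) *
        ∑ k, ∫ z, bumpWeight z * z k * fderiv ℝ f (x + δ x • z) (Pi.single k 1) := by
  have hfc : Continuous fun z => fderiv ℝ f (x + δ x • z) :=
    (hfd.continuous_fderiv (by norm_num)).comp (by fun_prop)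
  let F' : Dom3 → Dom3 →L[ℝ] ℝ := fun z => bumpWeight z •
    (fderiv ℝ f (x + δ x • z)).comp
      (ContinuousLinearMap.id ℝ Dom3 + (fderiv ℝ δ x).smulRight z)
  have hF'c : Continuous F' := by
    have h1 : Continuous fun z : Dom3 => (fderiv ℝ δ x).smulRight z :=
      (ContinuousLinearMap.smulRightL ℝ Dom3 Dom3 (fderiv ℝ δ x)).continuous
    exact continuous_bumpWeight.smul (hfc.clm_comp (continuous_const.add h1))
  have hF'i : Integrable F' := hF'c.integrable_of_hasCompactSupport
    hasCompactSupport_bumpWeight.smul_right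
  have key : HasFDerivAt (scaleAvg δ f) (∫ z, F' z) x := by
    refine (hasFDerivAt_integral_of_dominated_loc_of_lip' (s := univ)
      (bound := fun z => bumpWeight z * (2 * L)) univ_mem ?_ ?_ hF'c.aestronglyMeasurable ?_ ?_ ?_).2
    · exact fun y _ => (integrable_bumpWeight_mul
        (hf.continuous.comp (by fun_prop))).aestronglyMeasurable
    · exact integrable_bumpWeight_mul (hf.continuous.comp (by fun_prop))
    · exact Eventually.of_forall fun z y _ => norm_bumpWeight_mul_sub_le hδ hf y x z
    · exact (continuous_bumpWeight.integrable_of_hasCompactSupport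
        hasCompactSupport_bumpWeight).mul_const _
    · refine Eventually.of_forall fun z => ?_
      have h1 : HasFDerivAt (fun y => y + δ y • z)
          (ContinuousLinearMap.id ℝ Dom3 + (fderiv ℝ δ x).smulRight z) x :=
        (hasFDerivAt_id x).add (hx.hasFDerivAt.smul_const z)
      have h2 := (hfd.differentiable (by norm_num) (x + δ x • z)).hasFDerivAt.comp x h1
      exact h2.const_mul (bumpWeight z)
  have hk : ∀ v, Continuous fun z => fderiv ℝ f (x + δ x • z) v := fun v =>
    hfc.clm_apply continuous_const
  have hik : ∀ k : Fin 3, Integrable fun z =>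
      bumpWeight z * z k * fderiv ℝ f (x + δ x • z) (Pi.single k 1) := fun k => by
    simp only [mul_assoc]
    exact integrable_bumpWeight_mul ((continuous_apply k).mul (hk _))
  rw [key.fderiv, ContinuousLinearMap.integral_apply hF'i, ← integral_finsetSum _ fun k _ => hik k,
    ← integral_const_mul, ← integral_add (integrable_bumpWeight_mul (hk _))
      ((integrable_finsetSum _ fun k _ => hik k).const_mul _)]
  congr 1
  ext z
  have hz : ∀ A : Dom3 →L[ℝ] ℝ, A z = ∑ k, z k * A (Pi.single k 1) := fun A => by
    conv_lhs => rw [pi_eq_sum_univ' z, map_sum]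
    simp
  have hz' := hz (fderiv ℝ f (x + δ x • z))
  simp only [F', smul_apply, ContinuousLinearMap.comp_apply, add_apply, ContinuousLinearMap.id_apply,
    ContinuousLinearMap.smulRight_apply, map_add, map_smul, smul_eq_mul, hz']
  rw [mul_add, Finset.mul_sum, Finset.mul_sum, Finset.mul_sum]
  congr 1
  refine Finset.sum_congr rfl fun k _ => ?_
  ring

/-- The pairing of `u` with the gradient of an average, at points of the set `{δ > 0}`. -/
theorem sum_mul_fderiv_scaleAvg (hδ : LipschitzWith 1 δ) (hf : LipschitzWith L f)
    (hfd : ContDiff ℝ 2 f) {x : Dom3} (hx : DifferentiableAt ℝ δ x) (h0 : 0 < δ x) (a : Fin 3) :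
    ∑ b, u x (a, b) * fderiv ℝ (scaleAvg δ f) x (Pi.single b 1) =
      ∑ k, ∫ y, avgKernel u δ a k (x, y) * fderiv ℝ f y (Pi.single k 1) := by
  have hfc : ∀ k : Fin 3, Continuous fun z => fderiv ℝ f (x + δ x • z) (Pi.single k 1) := fun k =>
    ((hfd.continuous_fderiv (by norm_num)).comp (by fun_prop)).clm_apply continuous_const
  let P : Fin 3 → ℝ := fun k => ∫ z, bumpWeight z * fderiv ℝ f (x + δ x • z) (Pi.single k 1)
  let Q : Fin 3 → Fin 3 → ℝ := fun l k =>
    ∫ z, bumpWeight z * z l * fderiv ℝ f (x + δ x • z) (Pi.single k 1)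
  have hPi : ∀ k : Fin 3, Integrable fun z =>
      bumpWeight z * fderiv ℝ f (x + δ x • z) (Pi.single k 1) := fun k =>
    integrable_bumpWeight_mul (hfc k)
  have hQi : ∀ l k : Fin 3, Integrable fun z =>
      bumpWeight z * z l * fderiv ℝ f (x + δ x • z) (Pi.single k 1) := fun l k => by
    simp only [mul_assoc]
    exact integrable_bumpWeight_mul ((continuous_apply l).mul (hfc k))
  have hQ : ∀ l k, Q l k = Q k l := by
    intro l k
    have hF : ContDiff ℝ 2 fun z => f (x + δ x • z) := hfd.comp (by fun_prop)
    have hd : ∀ z v, fderiv ℝ (fun z => f (x + δ x • z)) z v =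
        δ x * fderiv ℝ f (x + δ x • z) v := by
      intro z v
      have h1 : HasFDerivAt (fun z => x + δ x • z) (δ x • ContinuousLinearMap.id ℝ Dom3) z :=
        ((hasFDerivAt_id z).const_smul (δ x)).const_add x
      have h2 := (hfd.differentiable (by norm_num) (x + δ x • z)).hasFDerivAt.comp z h1
      have h3 := h2.fderiv
      simp only [Function.comp_def] at h3
      rw [h3]
      simp
    have h := integral_bumpWeight_mul_fderiv_comm hF l k
    simp only [hd, mul_left_comm _ (δ x), integral_const_mul] at h
    exact mul_left_cancel₀ h0.ne' h
  have hrhs : ∀ k, ∫ y, avgKernel u δ a k (x, y) * fderiv ℝ f y (Pi.single k 1) =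
      u x (a, k) * P k + mulGrad u δ x a * Q k k + mulGrad u δ x k * Q a k
        - if a = k then ∑ l, mulGrad u δ x l * Q l k else 0 := by
    intro k
    have i2 : Integrable fun z => u x (a, k) *
        (bumpWeight z * fderiv ℝ f (x + δ x • z) (Pi.single k 1)) +
        mulGrad u δ x a * (bumpWeight z * z k * fderiv ℝ f (x + δ x • z) (Pi.single k 1)) :=
      ((hPi k).const_mul _).add ((hQi k k).const_mul _)
    have i3 : Integrable fun z => u x (a, k) *
        (bumpWeight z * fderiv ℝ f (x + δ x • z) (Pi.single k 1)) +
        mulGrad u δ x a * (bumpWeight z * z k * fderiv ℝ f (x + δ x • z) (Pi.single k 1)) +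
        mulGrad u δ x k * (bumpWeight z * z a * fderiv ℝ f (x + δ x • z) (Pi.single k 1)) :=
      i2.add ((hQi a k).const_mul _)
    have e3 := integral_add i2 ((hQi a k).const_mul (mulGrad u δ x k))
    rw [integral_add ((hPi k).const_mul _) ((hQi k k).const_mul _)] at e3
    simp only [integral_const_mul] at e3
    rw [← integral_scaledKernel_mul h0]
    by_cases hak : a = k
    · have i4 : Integrable fun z => ∑ l, mulGrad u δ x l *
          (bumpWeight z * z l * fderiv ℝ f (x + δ x • z) (Pi.single k 1)) :=
        integrable_finsetSum _ fun l _ => (hQi l k).const_mul _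
      have e4 := integral_sub i3 i4
      rw [e3, integral_finsetSum _ fun l _ => (hQi l k).const_mul _] at e4
      simp only [integral_const_mul] at e4
      simp only [hak, if_true, P, Q] at e4 ⊢
      rw [← e4]
      congr 1
      ext z
      simp only [scaledKernel, if_true, Fin.sum_univ_three]
      ring
    · simp only [hak, if_false, P, Q, sub_zero]
      rw [← e3]
      congr 1
      ext z
      simp only [scaledKernel, hak, if_false]
      ring
  have hlhs : ∀ b, fderiv ℝ (scaleAvg δ f) x (Pi.single b 1) =
      P b + fderiv ℝ δ x (Pi.single b 1) * ∑ k, Q k k := fun b =>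
    fderiv_scaleAvg hδ hf (hfd.of_le (by norm_num)) hx b
  simp only [hrhs, hlhs, Finset.sum_sub_distrib, Finset.sum_ite_eq, Finset.mem_univ, if_true,
    hQ a]
  have hv : mulGrad u δ x a = ∑ b, u x (a, b) * fderiv ℝ δ x (Pi.single b 1) := rfl
  simp only [Finset.sum_add_distrib, mul_add]
  rw [← Finset.mul_sum, hv, Finset.sum_mul]
  simp only [mul_assoc]
  ring

/-- Where `δ` vanishes, averaging does not change the gradient. -/
theorem fderiv_scaleAvg_of_eq_zero (hδ : LipschitzWith 1 δ) (hf : LipschitzWith L f)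
    (hfd : ContDiff ℝ 1 f) (hδ0 : ∀ x, 0 ≤ δ x) {x : Dom3} (hx : DifferentiableAt ℝ δ x)
    (h0 : δ x = 0) (b : Fin 3) :
    fderiv ℝ (scaleAvg δ f) x (Pi.single b 1) =
      (∫ z, bumpWeight z) * fderiv ℝ f x (Pi.single b 1) := by
  have hmin : IsLocalMin δ x := Eventually.of_forall fun y => by rw [h0]; exact hδ0 y
  rw [fderiv_scaleAvg hδ hf hfd hx, hmin.fderiv_eq_zero]
  simp [h0, integral_mul_const]

end ScaleAverage

section TruncField

/-- The truncation of `u` at variable scale `δ`: it keeps `u` on `{δ = 0}` and replaces it elsewhere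
by the dual of averaging at scale `δ`. -/
def truncField (u : Dom3 → M33) (δ : Dom3 → ℝ) (y : Dom3) : M33 :=
  WithLp.toLp 2 fun p => {x | δ x = 0}.indicator (fun x => u x p) y +
    (∫ z, bumpWeight z)⁻¹ * ∫ x, avgKernel u δ p.1 p.2 (x, y)

variable {u : Dom3 → M33} {δ : Dom3 → ℝ}

theorem truncField_apply (y : Dom3) (a k : Fin 3) :
    truncField u δ y (a, k) = {x | δ x = 0}.indicator (fun x => u x (a, k)) y +
      (∫ z, bumpWeight z)⁻¹ * ∫ x, avgKernel u δ a k (x, y) := rfl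

theorem isSym3_truncField (hsym : ∀ x, IsSym3 (u x)) (y : Dom3) : IsSym3 (truncField u δ y) := by
  intro i j
  simp only [truncField_apply, avgKernel_symm hsym i j, hsym _ i j]

theorem periodicZ3_truncField (hu : PeriodicZ3 u) (hδ : PeriodicZ3 δ) :
    PeriodicZ3 (truncField u δ) := by
  intro y m
  ext ⟨a, k⟩
  have h1 := integral_add_right_eq_self (μ := volume)
    (fun x => avgKernel u δ a k (x, y + fun i => (m i : ℝ))) fun i => (m i : ℝ)
  simp only [avgKernel_add_int hu hδ] at h1
  simp only [truncField_apply, ← h1, indicator, mem_ofPred_eq, hδ y m, hu y m]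

theorem integrableOn_integral_avgKernel (hu : Measurable u) (hp : PeriodicZ3 u)
    (hint : IntegrableOn u unitBox) (hδ : LipschitzWith 1 δ) (h0 : ∀ x, 0 ≤ δ x)
    (hδp : PeriodicZ3 δ) (a k : Fin 3) :
    IntegrableOn (fun y => ∫ x, avgKernel u δ a k (x, y)) unitBox := by
  have h1 := integrableOn_avgKernel_mul hu hint hδ h0 (q := fun _ => 1) measurable_const (M := 1)
    (by simp) a k
  simp only [mul_one] at h1
  have h2 := (integral_unitBox_swap (fun m x y => avgKernel_add_int hp hδp a k m x y) h1).1
  rw [IntegrableOn, ← Measure.prod_restrict, Measure.restrict_univ] at h2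
  exact h2.integral_prod_right

theorem integrable_apply {μ : Measure Dom3} (h : Integrable u μ) (p : Fin 3 × Fin 3) :
    Integrable (fun x => u x p) μ :=
  (EuclideanSpace.proj (𝕜 := ℝ) p).integrable_comp h

theorem integrableOn_truncField (hu : Measurable u) (hp : PeriodicZ3 u)
    (hint : IntegrableOn u unitBox) (hδ : LipschitzWith 1 δ) (h0 : ∀ x, 0 ≤ δ x)
    (hδp : PeriodicZ3 δ) : IntegrableOn (truncField u δ) unitBox := by
  have hG : MeasurableSet {x | δ x = 0} := hδ.continuous.measurable (measurableSet_singleton 0)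
  have h : Integrable (fun y p => truncField u δ y p) (volume.restrict unitBox) :=
    Integrable.of_eval fun p => ((integrable_apply hint p).indicator hG).add
      ((integrableOn_integral_avgKernel hu hp hint hδ h0 hδp p.1 p.2).const_mul _)
  exact (EuclideanSpace.equiv (Fin 3 × Fin 3) ℝ).symm.toContinuousLinearMap.integrable_comp h

theorem sum_mul_fderiv_scaleAvg_ae (hδ : LipschitzWith 1 δ) (h0 : ∀ x, 0 ≤ δ x) {f : Dom3 → ℝ}
    {L : ℝ≥0} (hf : LipschitzWith L f) (hfd : ContDiff ℝ 2 f) (a : Fin 3) :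
    ∀ᵐ x, ∑ b, u x (a, b) * fderiv ℝ (scaleAvg δ f) x (Pi.single b 1) =
      ∑ k, ((∫ z, bumpWeight z) * ({x | δ x = 0}.indicator (fun x => u x (a, k)) x *
        fderiv ℝ f x (Pi.single k 1)) +
        ∫ y, avgKernel u δ a k (x, y) * fderiv ℝ f y (Pi.single k 1)) := by
  filter_upwards [hδ.ae_differentiableAt] with x hx
  rcases (h0 x).eq_or_lt with h | h
  · refine Finset.sum_congr rfl fun k _ => ?_
    rw [fderiv_scaleAvg_of_eq_zero hδ hf (hfd.of_le (by norm_num)) h0 hx h.symm,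
      indicator_of_mem (by exact h.symm)]
    simp only [avgKernel_eq_zero_of_eq_zero h.symm, zero_mul, integral_zero]
    ring
  · rw [sum_mul_fderiv_scaleAvg hδ hf hfd hx h]
    refine Finset.sum_congr rfl fun k _ => ?_
    rw [indicator_of_notMem (by exact h.ne')]
    ring

theorem distDivFreeTorus_truncField (hu : Measurable u) (hp : PeriodicZ3 u)
    (hint : IntegrableOn u unitBox) (hdiv : DistDivFreeTorus u) (hδ : LipschitzWith 1 δ)
    (h0 : ∀ x, 0 ≤ δ x) (hδp : PeriodicZ3 δ) : DistDivFreeTorus (truncField u δ) := by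
  intro f hf hfp a
  have hfc : Continuous (fderiv ℝ f) := hf.continuous_fderiv (by simp)
  obtain ⟨L, hL⟩ := hfp.fderiv.exists_bound hfc
  have hfL : LipschitzWith L f :=
    lipschitzWith_of_nnnorm_fderiv_le (hf.differentiable (by simp)) hL
  have hqc : ∀ k : Fin 3, Continuous fun y => fderiv ℝ f y (Pi.single k 1) := fun k =>
    hfc.clm_apply continuous_const
  have hqL : ∀ (k : Fin 3) y, ‖fderiv ℝ f y (Pi.single k 1)‖ ≤ L := fun k y => by
    have := ContinuousLinearMap.le_of_opNorm_le _ (hL y) (Pi.single k 1)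
    simpa [Pi.norm_single] using this
  have hG : MeasurableSet {x | δ x = 0} := hδ.continuous.measurable (measurableSet_singleton 0)
  have hmul : ∀ (k : Fin 3) {v : Dom3 → ℝ}, IntegrableOn v unitBox →
      IntegrableOn (fun x => v x * fderiv ℝ f x (Pi.single k 1)) unitBox := fun k v hv =>
    Integrable.mul_bdd (c := L) hv (hqc k).aestronglyMeasurable (Eventually.of_forall (hqL k))
  have hI1 : ∀ k, IntegrableOn (fun x => {x | δ x = 0}.indicator (fun x => u x (a, k)) x *
      fderiv ℝ f x (Pi.single k 1)) unitBox := fun k =>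
    hmul k ((integrable_apply hint (a, k)).indicator hG)
  have hI2 : ∀ k, IntegrableOn (fun y => (∫ x, avgKernel u δ a k (x, y)) *
      fderiv ℝ f y (Pi.single k 1)) unitBox := fun k =>
    hmul k (integrableOn_integral_avgKernel hu hp hint hδ h0 hδp a k)
  have hF := fun k => integrableOn_avgKernel_mul hu hint hδ h0 (hqc k).measurable (hqL k) a k
  have hI3 : ∀ k, IntegrableOn (fun x => ∫ y, avgKernel u δ a k (x, y) *
      fderiv ℝ f y (Pi.single k 1)) unitBox := fun k => by
    have h2 := hF k
    rw [IntegrableOn, ← Measure.prod_restrict, Measure.restrict_univ] at h2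
    exact h2.integral_prod_left
  have hswap : ∀ k, ∫ x in unitBox, ∫ y, avgKernel u δ a k (x, y) *
      fderiv ℝ f y (Pi.single k 1) = ∫ y in unitBox, (∫ x, avgKernel u δ a k (x, y)) *
      fderiv ℝ f y (Pi.single k 1) := fun k => by
    have h2 := (integral_unitBox_swap (fun m x y => by
      simp only [avgKernel_add_int hp hδp a k m x y, hfp.fderiv y m]) (hF k)).2
    simpa only [integral_mul_const] using h2
  have key := hdiv.integral_lipschitz hint (scaleAvg_lipschitz hδ hfL) (scaleAvg_periodic hδp hfp) a
  rw [integral_congr_ae (ae_restrict_of_ae (sum_mul_fderiv_scaleAvg_ae hδ h0 hfL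
    (contDiff_infty.1 hf 2) a)),
    integral_finsetSum _ fun k _ => ((hI1 k).const_mul _).fun_add (hI3 k)] at key
  simp only [fun k => integral_add ((hI1 k).const_mul (∫ z, bumpWeight z)) (hI3 k),
    integral_const_mul, hswap] at key
  have hc := integral_bumpWeight_pos.ne'
  simp only [truncField_apply, add_mul, mul_assoc]
  rw [integral_finsetSum _ fun k _ => (hI1 k).fun_add ((hI2 k).const_mul _)]
  simp only [fun k => integral_add (hI1 k) ((hI2 k).const_mul (∫ z, bumpWeight z)⁻¹),
    integral_const_mul]
  refine mul_left_cancel₀ hc ?_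
  refine Eq.trans ?_ (key.trans (mul_zero _).symm)
  rw [Finset.mul_sum]
  refine Finset.sum_congr rfl fun k _ => ?_
  rw [mul_add, mul_inv_cancel_left₀ hc]

end TruncField

section Bounds

variable {u : Dom3 → M33}

/-- The averaging scale: a quarter of the distance to `G`. -/
def quarterDist (G : Set Dom3) (x : Dom3) : ℝ := infDist x G / 4

theorem quarterDist_nonneg (G : Set Dom3) (x : Dom3) : 0 ≤ quarterDist G x :=
  div_nonneg infDist_nonneg (by norm_num)

theorem quarterDist_lipschitz (G : Set Dom3) : LipschitzWith 1 (quarterDist G) := by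
  refine LipschitzWith.of_dist_le_mul fun x y => ?_
  have h := (lipschitz_infDist_pt G).dist_le_mul x y
  rw [Real.dist_eq] at h ⊢
  have h2 : quarterDist G x - quarterDist G y = (infDist x G - infDist y G) / 4 := by
    simp only [quarterDist]; ring
  rw [h2, abs_div, abs_of_pos (by norm_num : (0 : ℝ) < 4)]
  have := abs_nonneg (infDist x G - infDist y G)
  linarith

theorem quarterDist_eq_zero {G : Set Dom3} (hG : IsClosed G) (hne : G.Nonempty) {x : Dom3} :
    quarterDist G x = 0 ↔ x ∈ G := by
  rw [hG.mem_iff_infDist_zero hne, quarterDist, div_eq_zero_iff]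
  norm_num

theorem quarterDist_periodic {G : Set Dom3} (hG : PeriodicZ3 (· ∈ G)) :
    PeriodicZ3 (quarterDist G) := by
  intro x m
  have h : (IsometryEquiv.addRight (fun i => (m i : ℝ) : Dom3)) '' G = G := by
    ext y
    constructor
    · rintro ⟨z, hz, rfl⟩
      exact (hG z m).symm.mp hz
    · intro hy
      refine ⟨y - fun i => (m i : ℝ), ?_, by simp⟩
      have := hG (y - fun i => (m i : ℝ)) m
      simp only [sub_add_cancel] at this
      exact this.mp hy
  have h2 := infDist_image (IsometryEquiv.addRight (fun i => (m i : ℝ) : Dom3)).isometry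
    (x := x) (t := G)
  rw [h] at h2
  simp only [quarterDist]
  rw [← h2]
  rfl

/-- The dual average at a point `y` is controlled by the mean of `u` near a closest point of `G`. -/
theorem enorm_integral_avgKernel_le {G : Set Dom3} {p y : Dom3} (hd : 0 < infDist y G)
    (hpy : infDist y G = dist y p) (a k : Fin 3) :
    ‖∫ x, avgKernel u (quarterDist G) a k (x, y)‖ₑ ≤
      ENNReal.ofReal (2000 / infDist y G ^ 3) *
        ∫⁻ x in closedBall p (2 * infDist y G), ‖u x‖ₑ := by
  set d := infDist y G with hddef
  refine (enorm_integral_le_lintegral_enorm _).trans ?_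
  rw [← lintegral_const_mul' _ _ ENNReal.ofReal_ne_top,
    ← lintegral_indicator measurableSet_closedBall]
  refine lintegral_mono fun x => ?_
  have h0 := quarterDist_nonneg G x
  rcases lt_or_ge (quarterDist G x) (dist x y) with hlt | hge
  · rw [avgKernel_eq_zero_of_lt h0 hlt]
    simp
  have h1 : infDist y G ≤ infDist x G + dist y x := infDist_le_infDist_add_dist
  have h2 : infDist x G ≤ infDist y G + dist x y := infDist_le_infDist_add_dist
  rw [← hddef, dist_comm] at h1
  rw [← hddef] at h2
  have hq : infDist x G = 4 * quarterDist G x := by simp only [quarterDist]; ring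
  have hδ : d / 5 ≤ quarterDist G x := by linarith
  have hmem : x ∈ closedBall p (2 * d) := by
    rw [mem_closedBall]
    have := dist_triangle x y p
    linarith
  rw [indicator_of_mem hmem]
  have h3 := abs_avgKernel_le (u := u) (quarterDist_lipschitz G) (a := a) (k := k) (y := y) h0
  have h4 : |avgKernel u (quarterDist G) a k (x, y)| ≤ 2000 / d ^ 3 * ‖u x‖ := by
    refine h3.trans ?_
    have : (quarterDist G x)⁻¹ ^ 3 ≤ (d / 5)⁻¹ ^ 3 := by gcongr
    calc (quarterDist G x)⁻¹ ^ 3 * (16 * ‖u x‖) ≤ (d / 5)⁻¹ ^ 3 * (16 * ‖u x‖) := by gcongr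
      _ = 2000 / d ^ 3 * ‖u x‖ := by field_simp; ring
  rw [← Real.norm_eq_abs] at h4
  rw [← ofReal_norm, ← ofReal_norm, ← ENNReal.ofReal_mul (by positivity)]
  exact ENNReal.ofReal_le_ofReal h4

theorem setLIntegral_enorm_le_of_notMem_badSet {h : Dom3 → ℝ} {lam : ℝ} (hlam : 0 < lam)
    (hle : ∀ x, ‖u x‖ ≤ lam + h x) {p : Dom3}
    (hp : p ∉ badSet (fun x => ENNReal.ofReal (h x)) lam) {r : ℝ} (hr : 0 < r) :
    ∫⁻ x in closedBall p r, ‖u x‖ₑ ≤ ENNReal.ofReal (2 * lam * (2 * r) ^ 3) := by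
  have h1 : ∫⁻ x in closedBall p r, ENNReal.ofReal (h x) ≤ ENNReal.ofReal (lam * (2 * r) ^ 3) := by
    by_contra! h
    exact hp ⟨r, hr, h⟩
  calc ∫⁻ x in closedBall p r, ‖u x‖ₑ
      ≤ ∫⁻ x in closedBall p r, (ENNReal.ofReal lam + ENNReal.ofReal (h x)) := by
        refine lintegral_mono fun x => ?_
        rw [← ofReal_norm]
        exact (ENNReal.ofReal_le_ofReal (hle x)).trans ENNReal.ofReal_add_le
    _ = ENNReal.ofReal (lam * (2 * r) ^ 3) + ∫⁻ x in closedBall p r, ENNReal.ofReal (h x) := by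
        rw [lintegral_add_left measurable_const, setLIntegral_const, volume_closedBall_pi3 _ hr.le,
          ENNReal.ofReal_mul hlam.le]
    _ ≤ _ := by
        refine (add_le_add_right h1 _).trans ?_
        rw [← ENNReal.ofReal_add (by positivity) (by positivity)]
        exact ENNReal.ofReal_le_ofReal (by linarith)

theorem norm_M33_le {A : M33} {c : ℝ} (h : ∀ a k : Fin 3, |A (a, k)| ≤ c) : ‖A‖ ≤ 3 * c := by
  have hc : 0 ≤ c := (abs_nonneg _).trans (h 0 0)
  rw [EuclideanSpace.norm_eq]
  refine Real.sqrt_le_iff.2 ⟨by positivity, ?_⟩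
  calc ∑ i, ‖A i‖ ^ 2 ≤ ∑ _i : Fin 3 × Fin 3, c ^ 2 := by
        refine Finset.sum_le_sum fun i _ => ?_
        rw [Real.norm_eq_abs]
        exact pow_le_pow_left₀ (abs_nonneg _) (h i.1 i.2) 2
    _ = (3 * c) ^ 2 := by simp; ring

theorem truncField_eq_of_mem {G : Set Dom3} (hG : IsClosed G) {y : Dom3} (hy : y ∈ G) :
    truncField u (quarterDist G) y = u y := by
  have hy0 := (quarterDist_eq_zero hG ⟨y, hy⟩).2 hy
  ext ⟨a, k⟩
  have hT : ∀ x, avgKernel u (quarterDist G) a k (x, y) = 0 := by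
    intro x
    by_cases hx : quarterDist G x = 0
    · exact avgKernel_eq_zero_of_eq_zero hx
    have h0 := quarterDist_nonneg G x
    refine avgKernel_eq_zero_of_lt h0 ?_
    have h1 : infDist x G ≤ dist x y := infDist_le_dist_of_mem hy
    have h2 : 0 < quarterDist G x := lt_of_le_of_ne h0 (Ne.symm hx)
    simp only [quarterDist] at h2 ⊢
    linarith
  rw [truncField_apply, indicator_of_mem (by exact hy0)]
  simp [hT]

theorem norm_truncField_le_of_mem_badSet {h : Dom3 → ℝ} {lam : ℝ} (hlam : 0 < lam)
    (hle : ∀ x, ‖u x‖ ≤ lam + h x)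
    (hne : (badSet (fun x => ENNReal.ofReal (h x)) lam)ᶜ.Nonempty) {y : Dom3}
    (hy : y ∈ badSet (fun x => ENNReal.ofReal (h x)) lam) :
    ‖truncField u (quarterDist (badSet (fun x => ENNReal.ofReal (h x)) lam)ᶜ) y‖ ≤
      768000 * (∫ z, bumpWeight z)⁻¹ * lam := by
  set G := (badSet (fun x => ENNReal.ofReal (h x)) lam)ᶜ with hGdef
  have hG : IsClosed G := isOpen_badSet.isClosed_compl
  have hyG : y ∉ G := fun h => h hy
  have hd : 0 < infDist y G := (hG.notMem_iff_infDist_pos hne).1 hyG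
  obtain ⟨p, hp, hpy⟩ := hG.exists_infDist_eq_dist hne y
  have hc := integral_bumpWeight_pos
  have hT : ∀ a k, |∫ x, avgKernel u (quarterDist G) a k (x, y)| ≤ 256000 * lam := by
    intro a k
    have h1 := (enorm_integral_avgKernel_le (u := u) hd hpy a k).trans (mul_le_mul_right
      (setLIntegral_enorm_le_of_notMem_badSet hlam hle hp (r := 2 * infDist y G)
        (by positivity)) _)
    rw [← ENNReal.ofReal_mul (by positivity), ← ofReal_norm,
      ENNReal.ofReal_le_ofReal_iff (by positivity), Real.norm_eq_abs] at h1
    refine h1.trans_eq ?_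
    field_simp
    norm_num
  calc _ ≤ 3 * ((∫ z, bumpWeight z)⁻¹ * (256000 * lam)) := by
        refine norm_M33_le fun a k => ?_
        rw [truncField_apply, indicator_of_notMem (s := {x | quarterDist G x = 0})
          (fun h => hyG ((quarterDist_eq_zero hG hne).1 h)), zero_add, abs_mul,
          abs_of_pos (inv_pos.2 hc)]
        exact mul_le_mul_of_nonneg_left (hT a k) (inv_pos.2 hc).le
    _ = _ := by ring

end Bounds

section Truncation

variable {u v : Dom3 → M33}

theorem exists_measurable_representative (hint : IntegrableOn u unitBox)
    (hsym : ∀ x, IsSym3 (u x)) :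
    ∃ v : Dom3 → M33, Measurable v ∧ PeriodicZ3 v ∧ (∀ x, IsSym3 (v x)) ∧
      ∀ᵐ x, x ∈ unitBox → u x = v x := by
  have hm := hint.aestronglyMeasurable
  let w : Dom3 → M33 := hm.mk u
  have hw : Measurable w := hm.stronglyMeasurable_mk.measurable
  let s : Dom3 → M33 := fun x => WithLp.toLp 2 fun p => (w x p + w x p.swap) / 2
  have hwp : ∀ p, Measurable fun x => w x p := fun p =>
    (EuclideanSpace.proj (𝕜 := ℝ) p).measurable.comp hw
  have hs : Measurable s := (WithLp.measurable_toLp 2 _).comp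
    (measurable_pi_lambda _ fun p => ((hwp p).add (hwp p.swap)).div_const 2)
  refine ⟨fun x => s fun i => Int.fract (x i), hs.comp (measurable_pi_lambda _ fun i =>
    (measurable_pi_apply i).fract), fun x m => ?_, fun x i j => ?_, ?_⟩
  · simp only [Pi.add_apply, Int.fract_add_intCast]
  · simp only [s, Prod.swap_prod_mk]
    rw [add_comm]
  · filter_upwards [(ae_restrict_iff' measurableSet_unitBox).1 hm.ae_eq_mk] with x hx hxB
    have hfr : (fun i => Int.fract (x i)) = x := by
      ext i
      exact Int.fract_eq_self.2 (hxB i (mem_univ i))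
    have h1 : u x = w x := hx hxB
    rw [hfr]
    ext ⟨i, j⟩
    simp only [s, Prod.swap_prod_mk, ← h1, hsym x j i]
    ring

theorem DistDivFreeTorus.congr (hu : DistDivFreeTorus u) (h : ∀ᵐ x, x ∈ unitBox → u x = v x) :
    DistDivFreeTorus v := by
  intro ψ hψ hψp α
  rw [← hu ψ hψ hψp α]
  refine setIntegral_congr_ae measurableSet_unitBox ?_
  filter_upwards [h] with x hx hxB
  rw [hx hxB]

theorem exists_truncation_of_measurable (hu : Measurable u) (hp : PeriodicZ3 u)
    (hint : IntegrableOn u unitBox) (hsym : ∀ x, IsSym3 (u x)) (hdiv : DistDivFreeTorus u)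
    {lam K C : ℝ} (hlam : 0 < lam) (hK : K = 768000 * (∫ z, bumpWeight z)⁻¹)
    (hC : C = 27000 * (K + 2)) :
    ∃ ulam : Dom3 → M33, PeriodicZ3 ulam ∧ IntegrableOn ulam unitBox ∧
        (∀ x, IsSym3 (ulam x)) ∧
        (∀ᵐ x ∂volume.restrict unitBox, ‖ulam x‖ ≤ C * lam) ∧
        (∫ x in unitBox, ‖u x - ulam x‖) ≤
          C * (∫ x in unitBox ∩ {x | lam < ‖u x‖}, ‖u x‖) ∧
        volume (unitBox ∩ {x | u x ≠ ulam x}) ≤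
          ENNReal.ofReal
            (C * lam⁻¹ * (∫ x in unitBox ∩ {x | lam < ‖u x‖}, ‖u x‖)) ∧
        DistDivFreeTorus ulam := by
  have hK0 : 0 < K := by rw [hK]; have := integral_bumpWeight_pos; positivity
  have hS : MeasurableSet {x | lam < ‖u x‖} := measurableSet_lt measurable_const hu.norm
  set h : Dom3 → ℝ := {x | lam < ‖u x‖}.indicator fun x => ‖u x‖ with hh
  have hhm : Measurable h := hu.norm.indicator hS
  have hh0 : ∀ x, 0 ≤ h x := fun x => indicator_nonneg (fun _ _ => norm_nonneg _) x
  have hhi : IntegrableOn h unitBox := hint.norm.indicator hS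
  have hhp : PeriodicZ3 h := fun x m => by
    simp only [hh, indicator, mem_ofPred_eq, hp x m]
  have hle : ∀ x, ‖u x‖ ≤ lam + h x := fun x => by
    by_cases hx : lam < ‖u x‖
    · have : h x = ‖u x‖ := indicator_of_mem (s := {x | lam < ‖u x‖}) hx _
      linarith
    · linarith [hh0 x]
  have hA : ∫ x in unitBox ∩ {x | lam < ‖u x‖}, ‖u x‖ = ∫ x in unitBox, h x :=
    (setIntegral_indicator hS).symm
  rw [hA]
  set A := ∫ x in unitBox, h x with hAdef
  have hA0 : 0 ≤ A := integral_nonneg hh0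
  have hlA : ∫⁻ x in unitBox, ENNReal.ofReal (h x) = ENNReal.ofReal A :=
    (ofReal_integral_eq_lintegral_ofReal hhi (Eventually.of_forall hh0)).symm
  have hconst : ∀ c : ℝ, IntegrableOn (fun _ : Dom3 => c) unitBox := fun c =>
    integrableOn_const (by simp [volume_unitBox])
  rcases le_or_gt lam (27000 * A) with hbig | hsmall
  · refine ⟨fun _ => 0, fun _ _ => rfl, integrableOn_zero, fun _ _ _ => rfl, ?_, ?_, ?_, ?_⟩
    · refine Eventually.of_forall fun x => ?_
      rw [norm_zero, hC]
      positivity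
    · calc ∫ x in unitBox, ‖u x - 0‖ ≤ ∫ x in unitBox, (lam + h x) := by
            refine integral_mono_of_nonneg (Eventually.of_forall fun _ => norm_nonneg _)
              ((hconst lam).add hhi) (Eventually.of_forall fun x => ?_)
            simpa using hle x
        _ = lam + A := by
            rw [integral_add (hconst lam) hhi, setIntegral_const, Measure.real, volume_unitBox]
            simp [hAdef]
        _ ≤ C * A := by
            rw [hC]
            nlinarith [mul_nonneg hK0.le hA0]
    · refine (measure_mono inter_subset_left).trans ?_
      rw [volume_unitBox, ENNReal.one_le_ofReal, hC]
      have h1 : 1 ≤ lam⁻¹ * (27000 * A) := by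
        rw [inv_mul_eq_div, one_le_div hlam]
        exact hbig
      nlinarith [mul_nonneg hK0.le (zero_le_one.trans h1)]
    · intro ψ _ _ α
      simp
  · have hgp : PeriodicZ3 fun x => ENNReal.ofReal (h x) := fun x m => by simp only [hhp x m]
    set O := badSet (fun x => ENNReal.ofReal (h x)) lam with hO
    have hOm : MeasurableSet O := isOpen_badSet.measurableSet
    have hvol : volume (unitBox ∩ O) ≤ ENNReal.ofReal (27000 / lam * A) := by
      rw [ENNReal.ofReal_mul (by positivity), ← hlA]
      refine volume_unitBox_inter_badSet_le hgp hlam ?_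
      rw [hlA]
      exact ENNReal.ofReal_le_ofReal (by linarith)
    have hne : Oᶜ.Nonempty := by
      by_contra hemp
      rw [not_nonempty_iff_eq_empty, compl_empty_iff] at hemp
      rw [hemp, inter_univ, volume_unitBox, ENNReal.one_le_ofReal, div_mul_eq_mul_div,
        one_le_div hlam] at hvol
      linarith
    have hGp : PeriodicZ3 (· ∈ Oᶜ) := fun x m => by
      have := periodicZ3_mem_badSet (lam := lam) hgp x m
      simp only [mem_compl_iff, eq_iff_iff] at this ⊢
      exact not_congr this
    have hδ := quarterDist_lipschitz Oᶜ
    have hδ0 := quarterDist_nonneg Oᶜ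
    have hδp := quarterDist_periodic hGp
    have hiu := integrableOn_truncField hu hp hint hδ hδ0 hδp
    have hbd : ∀ y ∈ O, ‖truncField u (quarterDist Oᶜ) y‖ ≤ K * lam := fun y hy => by
      rw [hK]
      exact norm_truncField_le_of_mem_badSet hlam hle hne hy
    have heq : ∀ y ∉ O, truncField u (quarterDist Oᶜ) y = u y := fun y hy =>
      truncField_eq_of_mem isOpen_badSet.isClosed_compl hy
    refine ⟨truncField u (quarterDist Oᶜ), periodicZ3_truncField hp hδp, hiu,
      isSym3_truncField hsym, ae_restrict_of_ae ?_, ?_, ?_,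
      distDivFreeTorus_truncField hu hp hint hdiv hδ hδ0 hδp⟩
    · filter_upwards [ae_le_of_notMem_badSet hhp hhm.stronglyMeasurable hh0 hhi hlam] with x hx
      have hKl := mul_pos hK0 hlam
      by_cases hxO : x ∈ O
      · have := hbd x hxO
        rw [hC]
        linarith
      · rw [heq x hxO, hC]
        have h1 := hx hxO
        have h2 : ‖u x‖ ≤ lam := by
          by_contra! h3
          have : h x = ‖u x‖ := indicator_of_mem (s := {x | lam < ‖u x‖}) h3 _
          linarith
        linarith
    · have hi : IntegrableOn (O.indicator fun _ => (1 + K) * lam) unitBox :=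
        (hconst _).indicator hOm
      calc ∫ x in unitBox, ‖u x - truncField u (quarterDist Oᶜ) x‖
          ≤ ∫ x in unitBox, (O.indicator (fun _ => (1 + K) * lam) x + h x) := by
            refine integral_mono_of_nonneg (Eventually.of_forall fun _ => norm_nonneg _)
              (hi.add hhi) (Eventually.of_forall fun x => ?_)
            by_cases hxO : x ∈ O
            · simp only [indicator_of_mem hxO]
              linarith [norm_sub_le (u x) (truncField u (quarterDist Oᶜ) x), hbd x hxO, hle x]
            · simp only [indicator_of_notMem hxO, heq x hxO, sub_self, norm_zero, zero_add, hh0 x]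
        _ = volume.real (unitBox ∩ O) * ((1 + K) * lam) + A := by
            rw [integral_add hi hhi, setIntegral_indicator hOm, setIntegral_const, smul_eq_mul]
        _ ≤ 27000 / lam * A * ((1 + K) * lam) + A := by
            gcongr
            exact ENNReal.toReal_le_of_le_ofReal (by positivity) hvol
        _ = 27000 * (1 + K) * A + A := by field_simp
        _ ≤ C * A := by rw [hC]; linarith
    · refine (measure_mono ?_).trans (hvol.trans (ENNReal.ofReal_le_ofReal ?_))
      · refine inter_subset_inter_right _ fun x hx => ?_
        by_contra hxO
        exact hx (heq x hxO).symm
      · rw [div_eq_mul_inv, hC]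
        have := mul_nonneg (inv_pos.2 hlam).le hA0
        nlinarith [mul_nonneg hK0.le this]

end Truncation

/-- There is a dimensional constant `C > 0` such that any
divergence-free `u ∈ L¹(𝕋₃; Sym(3))` admits, for each `λ > 0`, a
divergence-free truncation `u_λ` with `‖u_λ‖_∞ ≤ Cλ`, strong `L¹`-stability and
small change of measure. -/
theorem divfree_L1_Linfty_truncation_torus :
    ∃ C : ℝ, 0 < C ∧
      ∀ u : Dom3 → M33, PeriodicZ3 u → IntegrableOn u unitBox →
      (∀ x, IsSym3 (u x)) → DistDivFreeTorus u →
      ∀ lam : ℝ, 0 < lam →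
      ∃ ulam : Dom3 → M33, PeriodicZ3 ulam ∧ IntegrableOn ulam unitBox ∧
        (∀ x, IsSym3 (ulam x)) ∧
        (∀ᵐ x ∂volume.restrict unitBox, ‖ulam x‖ ≤ C * lam) ∧
        (∫ x in unitBox, ‖u x - ulam x‖) ≤
          C * (∫ x in unitBox ∩ {x | lam < ‖u x‖}, ‖u x‖) ∧
        volume (unitBox ∩ {x | u x ≠ ulam x}) ≤
          ENNReal.ofReal
            (C * lam⁻¹ * (∫ x in unitBox ∩ {x | lam < ‖u x‖}, ‖u x‖)) ∧
        DistDivFreeTorus ulam := by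
  have hK : 0 < 768000 * (∫ z, bumpWeight z)⁻¹ := by
    have := integral_bumpWeight_pos
    positivity
  refine ⟨27000 * (768000 * (∫ z, bumpWeight z)⁻¹ + 2), by positivity, ?_⟩
  intro u hp hint hsym hdiv lam hlam
  obtain ⟨v, hvm, hvp, hvs, hae⟩ := exists_measurable_representative hint hsym
  have hset : (unitBox ∩ {x | lam < ‖u x‖} : Set Dom3) =ᵐ[volume]
      (unitBox ∩ {x | lam < ‖v x‖} : Set Dom3) := by
    refine eventuallyEq_set.2 ?_
    filter_upwards [hae] with x hx
    refine and_congr_right fun hxB => ?_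
    simp only [mem_ofPred_eq, hx hxB]
  have hA : ∫ x in unitBox ∩ {x | lam < ‖u x‖}, ‖u x‖ =
      ∫ x in unitBox ∩ {x | lam < ‖v x‖}, ‖v x‖ := by
    rw [setIntegral_congr_set hset]
    refine setIntegral_congr_ae (measurableSet_unitBox.inter
      (measurableSet_lt measurable_const hvm.norm)) ?_
    filter_upwards [hae] with x hx hxB
    rw [hx hxB.1]
  obtain ⟨w, h1, h2, h3, h4, h5, h6, h7⟩ := exists_truncation_of_measurable hvm hvp
    (hint.congr ((ae_restrict_iff' measurableSet_unitBox).2 hae)) hvs (hdiv.congr hae) hlam rfl rfl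
  refine ⟨w, h1, h2, h3, h4, ?_, ?_, h7⟩
  · rw [hA]
    refine (setIntegral_congr_ae measurableSet_unitBox ?_).trans_le h5
    filter_upwards [hae] with x hx hxB
    rw [hx hxB]
  · rw [hA]
    refine (measure_congr (eventuallyEq_set.2 ?_)).trans_le h6
    filter_upwards [hae] with x hx
    refine and_congr_right fun hxB => ?_
    simp only [mem_ofPred_eq, hx hxB]
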